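/- Every mass distribution μ on ℝ¹⁶ admits an equipartition into 60 = 15×2×2 boxes by a collection of 14 parallel hyperplanes and two additional non-parallel hyperplanes: there exist a unit vector u ∈ ℝ¹⁶, real numbers t_1 < t_2 < ... < t_{14}, unit vectors v and w, and real numbers s₁, s₂, with u, v, w pairwise non-parallel (no two equal up to sign), such that each of the 60 regions {x : t_i < ⟨x,u⟩ < t_{i+1}} ∩ {x : ⟨x,v⟩ ≶ s₁} ∩ {x : ⟨x,w⟩ ≶ s₂} (for 0 ≤ i ≤ 14, with t_0 = -∞, t_{15} = +∞, and all four sign choices) has μ-measure μ(ℝ¹⁶)/60. -/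

import Mathlib

open MeasureTheory

/-- The open slab between consecutive parallel hyperplanes orthogonal to `u`:
for `0 ≤ i ≤ n`, the region `{x : t i < ⟪x,u⟫ < t (i+1)}`, with the conventions
`t 0 = -∞` and `t (n+1) = +∞` (i.e. the corresponding inequality is dropped). -/
noncomputable def slab {d : ℕ} (u : EuclideanSpace ℝ (Fin d)) (t : ℕ → ℝ) (n i : ℕ) :
    Set (EuclideanSpace ℝ (Fin d)) :=
  {x | (1 ≤ i → t i < (inner ℝ x u : ℝ)) ∧ (i + 1 ≤ n → (inner ℝ x u : ℝ) < t (i + 1))}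

/-- The open halfspace below (`b = true`) or above (`b = false`) the hyperplane
orthogonal to `v` at level `s`. -/
def halfSp {d : ℕ} (v : EuclideanSpace ℝ (Fin d)) (s : ℝ) (b : Bool) :
    Set (EuclideanSpace ℝ (Fin d)) :=
  if b then {x | (inner ℝ x v : ℝ) < s} else {x | s < (inner ℝ x v : ℝ)}



namespace Equi

open Finset Equiv

abbrev HD (N : ℕ) := Fin (2 * N) × Bool

def md {N : ℕ} (d : HD N) : ℤ := 2 * (d.1 : ℤ) - 2 * N + 1

def vt {N : ℕ} (d : HD N) : ℤ := md d + (if d.2 then 1 else -1)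

abbrev Flag (n N : ℕ) := (Fin n → HD N) × Perm (Fin n)

/-- The vertices of a flag of the subdivided grid. -/
def PP {n N : ℕ} (a : Flag n N) (i : ℕ) : Fin n → ℤ :=
  fun k => if (a.2.symm k : ℕ) < i then md (a.1 k) else vt (a.1 k)

def ng {n : ℕ} {K : Type*} [DecidableEq K] (β : Fin n → K) (b : K) (p : Fin n → ℤ) : Fin n → ℤ :=
  fun k => if β k = b then - p k else p k

lemma z2_self (x : ZMod 2) : x + x = 0 := CharTwo.add_self_eq_zero x

/-- flipping the vertex, keeping the midpoint -/
def flipV {N : ℕ} (d : HD N) : HD N := (d.1, !d.2)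

lemma md_flipV {N : ℕ} (d : HD N) : md (flipV d) = md d := rfl

lemma sum_inv {α : Type*} [Fintype α] (f : α → ZMod 2) (g : α → α)
    (h1 : ∀ a, f (g a) = f a) (h2 : ∀ a, g a ≠ a) (h3 : ∀ a, g (g a) = a) :
    ∑ a, f a = 0 := by
  refine Finset.sum_involution (fun a _ => g a) ?_ ?_ ?_ ?_
  · intro a _; rw [h1]; exact z2_self _
  · intro a _ _; exact h2 a
  · intro a _; simp
  · intro a _; exact h3 a

/-- A function not involving the vertex `i0 < n` sums to zero. -/
lemma sum_missing {n N : ℕ} (i0 : ℕ) (hi0 : i0 < n) (g : (ℕ → Fin n → ℤ) → ZMod 2)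
    (hg : ∀ P P' : ℕ → Fin n → ℤ, (∀ i, i ≠ i0 → P i = P' i) → g P = g P') :
    ∑ a : Flag n N, g (PP a) = 0 := by
  rcases Nat.eq_zero_or_pos i0 with h0 | h0
  · subst h0
    let z : Fin n := ⟨0, hi0⟩
    refine sum_inv _ (fun a => (Function.update a.1 (a.2 z) (flipV (a.1 (a.2 z))), a.2)) ?_ ?_ ?_
    · intro a
      apply hg
      intro i hi
      funext k
      simp only [PP]
      by_cases hk : k = a.2 z
      · subst hk
        have : ((a.2.symm (a.2 z) : Fin n) : ℕ) < i := by simp [z]; omega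
        simp only [this, if_true, Function.update_self, md_flipV]
      · simp only [Function.update_of_ne hk]
    · intro a h
      have := congrFun (congrArg Prod.fst h) (a.2 z)
      simp [flipV] at this
      have h2 := congrArg Prod.snd this
      simp at h2
    · intro a
      simp [flipV]
  · let x : Fin n := ⟨i0 - 1, by omega⟩
    let y : Fin n := ⟨i0, hi0⟩
    have hxy : x ≠ y := by simp [x, y, Fin.ext_iff]; omega
    refine sum_inv _ (fun a => (a.1, a.2 * swap x y)) ?_ ?_ ?_
    · intro a
      apply hg
      intro i hi
      funext k
      simp only [PP]
      have : ((a.2 * swap x y).symm k : Fin n) = swap x y (a.2.symm k) := by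
        simp [Equiv.symm_apply_eq]
      rw [this]
      generalize a.2.symm k = m
      have : ((swap x y m : Fin n) : ℕ) < i ↔ (m : ℕ) < i := by
        rw [swap_apply_def]
        split_ifs with h1 h2
        · subst h1; simp [x, y]; omega
        · subst h2; simp [x, y]; omega
        · rfl
      simp only [this]
    · intro a h
      have := congrArg Prod.snd h
      simp at this
      exact hxy this
    · intro a
      simp [mul_assoc]

/-- moving the midpoint, keeping the vertex (identity if impossible) -/
def flipM {N : ℕ} (d : HD N) : HD N :=
  if d.2 then (if h : (d.1 : ℕ) + 1 < 2 * N then (⟨d.1 + 1, h⟩, false) else d)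
  else (if h : 1 ≤ (d.1 : ℕ) then (⟨d.1 - 1, by omega⟩, true) else d)

lemma flipM_spec {N : ℕ} (d : HD N) (h : |vt d| ≠ 2 * N) :
    vt (flipM d) = vt d ∧ flipM d ≠ d ∧ flipM (flipM d) = d := by
  obtain ⟨⟨a, ha⟩, b⟩ := d
  cases b
  · have h1 : 1 ≤ a := by
      by_contra hc
      apply h
      simp [vt, md]
      have : a = 0 := by omega
      subst this
      simp
    simp [flipM, h1, ha, vt, md]
    omega
  · have h1 : a + 1 < 2 * N := by
      by_contra hc
      apply h
      have : (a : ℤ) = 2 * N - 1 := by omega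
      simp [vt, md, this]
      ring_nf
      simp
    simp [flipM, h1, vt, md]
    omega

def negD {N : ℕ} (d : HD N) : HD N := (d.1.rev, !d.2)

lemma md_negD {N : ℕ} (d : HD N) : md (negD d) = - md d := by
  obtain ⟨⟨a, ha⟩, b⟩ := d
  simp [negD, md, Fin.rev]
  omega

lemma vt_negD {N : ℕ} (d : HD N) : vt (negD d) = - vt d := by
  have := md_negD d
  obtain ⟨⟨a, ha⟩, b⟩ := d
  simp only [vt, this]
  cases b <;> simp [negD] <;> omega

lemma negD_negD {N : ℕ} (d : HD N) : negD (negD d) = d := by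
  simp [negD]

lemma negD_ne {N : ℕ} (d : HD N) : negD d ≠ d := by
  intro h
  have := congrArg Prod.snd h
  simp [negD] at this

lemma sum_missing_last {n N : ℕ} {K : Type*} [DecidableEq K] (β : Fin n → K) (hn : 0 < n)
    (g : (ℕ → Fin n → ℤ) → ZMod 2)
    (hg : ∀ P P' : ℕ → Fin n → ℤ, (∀ i, i < n → P i = P' i) → g P = g P')
    (hs : ∀ (a : Flag n N) (k : Fin n), (∀ i, i < n → |PP a i k| = 2 * N) →
      g (fun i => ng β (β k) (PP a i)) = g (PP a)) :
    ∑ a : Flag n N, g (PP a) = 0 := by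
  let z : Fin n := ⟨n - 1, by omega⟩
  have key : ∀ (a : Flag n N) (i : ℕ), i < n → PP a i (a.2 z) = vt (a.1 (a.2 z)) := by
    intro a i hi
    have : ¬ (n - 1 < i) := by omega
    simp [PP, z, this]
  refine sum_inv _ (fun a => if |vt (a.1 (a.2 z))| = 2 * N
    then (fun k => if β k = β (a.2 z) then negD (a.1 k) else a.1 k, a.2)
    else (Function.update a.1 (a.2 z) (flipM (a.1 (a.2 z))), a.2)) ?_ ?_ ?_
  · intro a
    split_ifs with h
    · rw [← hs a (a.2 z) (fun i hi => by rw [key a i hi, h])]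
      congr 1
      funext i k
      simp only [PP, ng]
      split_ifs <;> simp [md_negD, vt_negD]
    · apply hg
      intro i hi
      funext k
      by_cases hk : k = a.2 z
      · subst hk
        rw [key a i hi]
        have := key (Function.update a.1 (a.2 z) (flipM (a.1 (a.2 z))), a.2) i hi
        simp only at this
        rw [this]
        simp [(flipM_spec _ h).1]
      · simp [PP, Function.update_of_ne hk]
  · intro a
    split_ifs with h
    · intro h2
      have := congrFun (congrArg Prod.fst h2) (a.2 z)
      simp at this
      exact negD_ne _ this
    · intro h2
      have := congrFun (congrArg Prod.fst h2) (a.2 z)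
      simp at this
      exact (flipM_spec _ h).2.1 this
  · intro a
    by_cases h : |vt (a.1 (a.2 z))| = 2 * N
    · simp only [h, if_true, vt_negD, abs_neg]
      ext : 1
      · funext k
        simp only
        split_ifs <;> simp [negD_negD]
      · rfl
    · simp only [h, if_false, Function.update_self, (flipM_spec _ h).1]
      simp [(flipM_spec _ h).2.2]


lemma md_abs {N : ℕ} (d : HD N) : |md d| < 2 * N := by
  obtain ⟨⟨a, ha⟩, b⟩ := d
  rw [abs_lt]; simp [md]; omega

lemma vt_abs {N : ℕ} (d : HD N) : |vt d| ≤ 2 * N := by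
  obtain ⟨⟨a, ha⟩, b⟩ := d
  rw [abs_le]; cases b <;> simp [vt, md] <;> omega

lemma PP_abs {n N : ℕ} (a : Flag n N) (i : ℕ) (k : Fin n) : |PP a i k| ≤ 2 * N := by
  unfold PP; split_ifs
  · exact (md_abs _).le
  · exact vt_abs _

lemma sum_left {n N : ℕ} (s : ℕ → (Fin n → ℤ) → ZMod 2) (l : ℕ) (hl : l ≤ n)
    (R : (ℕ → Fin n → ℤ) → ZMod 2)
    (hR : ∀ P P' : ℕ → Fin n → ℤ, (∀ i, l ≤ i → P i = P' i) → R P = R P') :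
    ∑ a : Flag n N, (∏ j ∈ range l, (s j (PP a j) + s j (PP a (j + 1)))) * R (PP a)
      = ∑ a : Flag n N, (∏ j ∈ range l, s j (PP a j)) * R (PP a) := by
  induction l generalizing R with
  | zero => simp
  | succ l ih =>
    have h1 := ih (by omega) (fun P => (s l (P l) + s l (P (l + 1))) * R P) (by
      intro P P' h
      rw [h l le_rfl, h (l + 1) (by omega), hR P P' (fun i hi => h i (by omega))])
    have h2 := sum_missing (n := n) (N := N) l (by omega)
      (fun P => (∏ j ∈ range l, s j (P j)) * (s l (P (l + 1)) * R P)) (by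
      intro P P' h
      rw [h (l + 1) (by omega), hR P P' (fun i hi => h i (by omega))]
      congr 1
      refine Finset.prod_congr rfl (fun j hj => ?_)
      rw [h j (by simp at hj; omega)])
    simp only [prod_range_succ, mul_assoc]
    rw [h1]
    simp only [add_mul, mul_add, sum_add_distrib]
    rw [h2, add_zero]

lemma sum_right {n N : ℕ} (s : ℕ → (Fin n → ℤ) → ZMod 2) (r : ℕ) : ∀ (l : ℕ) (hl : l + 1 + r = n)
    (L : (ℕ → Fin n → ℤ) → ZMod 2)
    (hL : ∀ P P' : ℕ → Fin n → ℤ, (∀ i, i ≤ l → P i = P' i) → L P = L P'),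
    ∑ a : Flag n N, L (PP a) * (∏ j ∈ Ico (l + 1) n, (s j (PP a (j - 1)) + s j (PP a j)))
      = ∑ a : Flag n N, L (PP a) * (∏ j ∈ Ico (l + 1) n, s j (PP a j)) := by
  induction r with
  | zero =>
    intro l hl L hL
    have : Ico (l + 1) n = ∅ := by simp; omega
    simp [this]
  | succ r ih =>
    intro l hl L hL
    have h1 := ih (l + 1) (by omega) (fun P => L P * (s (l + 1) (P l) + s (l + 1) (P (l + 1)))) (by
      intro P P' h
      rw [h l (by omega), h (l + 1) (by omega), hL P P' (fun i hi => h i (by omega))])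
    have h2 := sum_missing (n := n) (N := N) (l + 1) (by omega)
      (fun P => L P * s (l + 1) (P l) * (∏ j ∈ Ico (l + 1 + 1) n, s j (P j))) (by
      intro P P' h
      rw [h l (by omega), hL P P' (fun i hi => h i (by omega))]
      congr 1
      refine Finset.prod_congr rfl (fun j hj => ?_)
      rw [h j (by simp at hj; omega)])
    have h3 : ∀ f : ℕ → ZMod 2, ∏ j ∈ Ico (l + 1) n, f j = f (l + 1) * ∏ j ∈ Ico (l + 1 + 1) n, f j :=
      fun f => Finset.prod_eq_prod_Ico_succ_bot (by omega) f
    simp only [h3]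
    simp only [← mul_assoc]
    simp only [Nat.add_sub_cancel] at *
    rw [h1]
    simp only [add_mul, mul_add, sum_add_distrib]
    rw [h2, zero_add]

/-- Equivariance on the boundary of the grid. -/
def EqV {n : ℕ} (N : ℕ) {K : Type*} [DecidableEq K] (β : Fin n → K) (χ : K → ZMod 2)
    (s : (Fin n → ℤ) → ZMod 2) : Prop :=
  ∀ p : Fin n → ℤ, (∀ k, |p k| ≤ 2 * N) → ∀ k, |p k| = 2 * N → s (ng β (β k) p) = s p + χ (β k)

lemma sum_inv_zero {n N : ℕ} {K : Type*} [DecidableEq K] (β : Fin n → K)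
    (s : ℕ → (Fin n → ℤ) → ZMod 2) (χ : ℕ → K → ZMod 2) (hs : ∀ j, EqV N β (χ j) (s j))
    (j0 : ℕ) (hj0 : j0 < n) (h0 : ∀ b, χ j0 b = 0) :
    ∑ a : Flag n N, ∏ j ∈ range n, s j (PP a j) = 0 := by
  have hsplit : ∀ f : ℕ → ZMod 2, ∏ j ∈ range n, f j
      = (∏ j ∈ range j0, f j) * (f j0 * ∏ j ∈ Ico (j0 + 1) n, f j) := by
    intro f
    rw [← Finset.prod_eq_prod_Ico_succ_bot hj0 f, Finset.prod_range_mul_prod_Ico _ hj0.le]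
  simp only [hsplit]
  have h1 := sum_left (n := n) (N := N) s j0 hj0.le
    (fun P => s j0 (P j0) * ∏ j ∈ Ico (j0 + 1) n, (s j (P (j - 1)) + s j (P j))) (by
      intro P P' h
      rw [h j0 le_rfl]
      congr 1
      refine Finset.prod_congr rfl (fun j hj => ?_)
      simp at hj
      rw [h j (by omega), h (j - 1) (by omega)])
  have h2 := sum_right (n := n) (N := N) s (n - j0 - 1) j0 (by omega)
    (fun P => (∏ j ∈ range j0, s j (P j)) * s j0 (P j0)) (by
      intro P P' h
      rw [h j0 le_rfl]
      congr 1
      refine Finset.prod_congr rfl (fun j hj => ?_)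
      simp at hj
      rw [h j (by omega)])
  have h3 := sum_missing_last (n := n) (N := N) β (by omega)
    (fun P => (∏ j ∈ range j0, (s j (P j) + s j (P (j + 1)))) *
      (s j0 (P j0) * ∏ j ∈ Ico (j0 + 1) n, (s j (P (j - 1)) + s j (P j)))) (by
      intro P P' h
      rw [h j0 hj0]
      congr 1
      · refine Finset.prod_congr rfl (fun j hj => ?_)
        simp at hj
        rw [h j (by omega), h (j + 1) (by omega)]
      · congr 1
        refine Finset.prod_congr rfl (fun j hj => ?_)
        simp at hj
        rw [h j (by omega), h (j - 1) (by omega)]) (by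
      intro a k hk
      simp only
      have hP : ∀ j i, i < n → s j (ng β (β k) (PP a i)) = s j (PP a i) + χ j (β k) :=
        fun j i hi => hs j (PP a i) (PP_abs a i) k (hk i hi)
      have aux : ∀ x y c : ZMod 2, (x + c) + (y + c) = x + y := by decide
      rw [hP j0 j0 hj0, h0, add_zero]
      congr 1
      · refine Finset.prod_congr rfl (fun j hj => ?_)
        simp at hj
        rw [hP j j (by omega), hP j (j + 1) (by omega), aux]
      · congr 1
        refine Finset.prod_congr rfl (fun j hj => ?_)
        simp at hj
        rw [hP j j (by omega), hP j (j - 1) (by omega), aux])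
  simp only [← mul_assoc] at h1 h2 h3 ⊢
  rw [← h2, ← h1, h3]

lemma EqV.add {n N : ℕ} {K : Type*} [DecidableEq K] {β : Fin n → K} {χ χ' : K → ZMod 2}
    {s s' : (Fin n → ℤ) → ZMod 2} (h : EqV N β χ s) (h' : EqV N β χ' s') :
    EqV N β (fun b => χ b + χ' b) (fun p => s p + s' p) := by
  intro p hp k hk
  simp only
  rw [h p hp k hk, h' p hp k hk]
  ring

lemma sum_indep {n N : ℕ} {K : Type*} [DecidableEq K] (β : Fin n → K)
    (s s' : ℕ → (Fin n → ℤ) → ZMod 2) (χ : ℕ → K → ZMod 2) (hs : ∀ j, EqV N β (χ j) (s j))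
    (hs' : ∀ j, EqV N β (χ j) (s' j)) :
    ∑ a : Flag n N, ∏ j ∈ range n, s j (PP a j) = ∑ a : Flag n N, ∏ j ∈ range n, s' j (PP a j) := by
  have key : ∀ m, m ≤ n → ∑ a : Flag n N, ∏ j ∈ range n, s j (PP a j) =
      ∑ a : Flag n N, ∏ j ∈ range n, (if j < m then s' j (PP a j) else s j (PP a j)) := by
    intro m
    induction m with
    | zero => simp
    | succ m ih =>
      intro hm
      rw [ih (by omega)]
      have h := sum_inv_zero (n := n) (N := N) β
        (fun j p => if j = m then s j p + s' j p else if j < m then s' j p else s j p)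
        (fun j b => if j = m then χ j b + χ j b else χ j b) (by
          intro j
          by_cases hj : j = m
          · simp only [hj, if_true]
            exact (hs m).add (hs' m)
          · simp only [hj, if_false]
            by_cases hj2 : j < m
            · simp only [hj2, if_true]; exact hs' j
            · simp only [hj2, if_false]; exact hs j) m (by omega) (by
          intro b; simp only [if_true]; exact z2_self _)
      have hmem : m ∈ range n := by simp; omega
      rw [← sub_eq_zero, ← h, ← Finset.sum_sub_distrib]
      refine Finset.sum_congr rfl (fun a _ => ?_)
      rw [← Finset.mul_prod_erase _ _ hmem, ← Finset.mul_prod_erase _ _ hmem,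
        ← Finset.mul_prod_erase _ _ hmem]
      have e1 : ∏ x ∈ (range n).erase m, (if x < m + 1 then s' x (PP a x) else s x (PP a x)) =
          ∏ x ∈ (range n).erase m, (if x < m then s' x (PP a x) else s x (PP a x)) := by
        refine Finset.prod_congr rfl (fun j hj => ?_)
        have hj : j ≠ m := (Finset.mem_erase.1 hj).1
        have : j < m + 1 ↔ j < m := by omega
        simp only [this]
      have e2 : ∏ x ∈ (range n).erase m, (if x = m then s x (PP a x) + s' x (PP a x) else
            if x < m then s' x (PP a x) else s x (PP a x)) =
          ∏ x ∈ (range n).erase m, (if x < m then s' x (PP a x) else s x (PP a x)) := by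
        refine Finset.prod_congr rfl (fun j hj => ?_)
        have hj : j ≠ m := (Finset.mem_erase.1 hj).1
        simp only [hj, if_false]
      rw [e1, e2]
      simp
      have aux : ∀ x y z : ZMod 2, x * z - y * z = (x + y) * z := by decide
      exact aux _ _ _
  rw [key n le_rfl]
  refine Finset.sum_congr rfl (fun a _ => ?_)
  refine Finset.prod_congr rfl (fun j hj => ?_)
  simp at hj
  simp [hj]

lemma sum_expand {n N : ℕ} (s : ℕ → (Fin n → ℤ) → ZMod 2) :
    ∑ a : Flag n N, (∏ j ∈ range n, (s j (PP a j) + s j (PP a (j + 1))))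
      = ∑ a : Flag n N, (∏ j ∈ range n, s j (PP a j)) := by
  simpa using sum_left (n := n) (N := N) s n le_rfl (fun _ => 1) (fun _ _ _ => rfl)

section ref
variable {n N : ℕ} {K : Type*} [DecidableEq K]

open Classical in
/-- Reference sign function of block `b`: sign of the first boundary coordinate in the block. -/
noncomputable def rf (N : ℕ) (β : Fin n → K) (b : K) (p : Fin n → ℤ) : ZMod 2 :=
  if ∃ k, β k = b ∧ p k = 2 * N ∧ ∀ k' < k, β k' = b → |p k'| ≠ 2 * N then 1 else 0

lemma rf_congr (β : Fin n → K) (b : K) (p p' : Fin n → ℤ)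
    (h : ∀ k, β k = b → ((|p k| = 2 * N ↔ |p' k| = 2 * N) ∧ (p k = 2 * N ↔ p' k = 2 * N))) :
    rf N β b p = rf N β b p' := by
  unfold rf
  congr 1
  apply propext
  refine exists_congr (fun k => and_congr_right (fun hk => and_congr (h k hk).2 ?_))
  refine forall_congr' (fun k' => imp_congr_right (fun _ => ?_))
  refine forall_congr' (fun hk' => ?_)
  exact not_congr (h k' hk').1

lemma rf_none (β : Fin n → K) (b : K) (p : Fin n → ℤ)
    (h : ∀ k, β k = b → |p k| ≠ 2 * N) : rf N β b p = 0 := by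
  unfold rf
  rw [if_neg]
  rintro ⟨k, hk, h1, -⟩
  apply h k hk
  rw [h1]; simp

lemma rf_first (β : Fin n → K) (b : K) (p : Fin n → ℤ) (k : Fin n) (hk : β k = b)
    (h1 : |p k| = 2 * N) (h2 : ∀ k' < k, β k' = b → |p k'| ≠ 2 * N) :
    rf N β b p = if p k = 2 * N then 1 else 0 := by
  unfold rf
  congr 1
  apply propext
  constructor
  · rintro ⟨l, hl, h3, h4⟩
    have h3' : |p l| = 2 * N := by rw [h3]; simp
    rcases lt_trichotomy l k with h | h | h
    · exact absurd h3' (h2 l h hl)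
    · rw [← h]; exact h3
    · exact absurd h1 (h4 k h hk)
  · intro h
    exact ⟨k, hk, h, h2⟩

lemma exists_first (β : Fin n → K) (b : K) (p : Fin n → ℤ) (k : Fin n) (hk : β k = b)
    (h1 : |p k| = 2 * N) : ∃ l ≤ k, β l = b ∧ |p l| = 2 * N ∧
      ∀ k' < l, β k' = b → |p k'| ≠ 2 * N := by
  let S := univ.filter (fun l => β l = b ∧ |p l| = 2 * N)
  have hS : S.Nonempty := ⟨k, by simp [S, hk, h1]⟩
  have hm := S.min'_mem hS
  simp only [S, mem_filter, mem_univ, true_and] at hm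
  refine ⟨S.min' hS, S.min'_le k (by simp [S, hk, h1]), hm.1, hm.2, ?_⟩
  intro k' hk' hb hc
  exact absurd (S.min'_le k' (by simp [S, hb, hc])) (not_le.2 hk')

lemma rf_EqV (hN : 0 < N) (β : Fin n → K) (b : K) :
    EqV N β (fun c => if c = b then 1 else 0) (rf N β b) := by
  intro p hp k hk
  by_cases hb : β k = b
  · obtain ⟨l, -, hl1, hl2, hl3⟩ := exists_first β b p k hb hk
    rw [rf_first β b p l hl1 hl2 hl3, rf_first β b (ng β (β k) p) l hl1]
    · simp only [hb, if_true, ng, hl1]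
      rcases (abs_eq (by positivity : (0 : ℤ) ≤ 2 * N)).1 hl2 with h | h
      · rw [h, if_pos rfl, if_neg (by omega)]; decide
      · rw [h, neg_neg, if_pos rfl, if_neg (by omega)]; decide
    · simp [ng, hl1, hb, hl2]
    · intro k' hk' hb'
      simp [ng, hb, hb']
      simpa using hl3 k' hk' hb'
  · simp only [hb, if_false, add_zero]
    apply rf_congr
    intro l hl
    have : ¬ β l = β k := by rw [hl]; exact fun h => hb h.symm
    simp [ng, this]

variable [Fintype K]

noncomputable def rfs (N : ℕ) (β : Fin n → K) (χ : K → ZMod 2) (p : Fin n → ℤ) : ZMod 2 :=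
  ∑ b, χ b * rf N β b p

lemma rfs_EqV (hN : 0 < N) (β : Fin n → K) (χ : K → ZMod 2) :
    EqV N β χ (rfs N β χ) := by
  intro p hp k hk
  unfold rfs
  simp only [fun b => rf_EqV hN β b p hp k hk, mul_add, sum_add_distrib]
  simp

lemma PP_succ_ne (a : Flag n N) (j k : Fin n) (h : k ≠ a.2 j) :
    PP a (j + 1) k = PP a j k := by
  have : a.2.symm k ≠ j := fun h' => h (by rw [← h']; simp)
  have : ((a.2.symm k : Fin n) : ℕ) ≠ j := fun h' => this (Fin.ext h')
  unfold PP
  have : ((a.2.symm k : Fin n) : ℕ) < j + 1 ↔ ((a.2.symm k : Fin n) : ℕ) < j := by omega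
  simp only [this]

noncomputable def Dl (β : Fin n → K) (a : Flag n N) (j : Fin n) : ZMod 2 :=
  rf N β (β (a.2 j)) (PP a j) + rf N β (β (a.2 j)) (PP a (j + 1))

lemma rfs_diff (β : Fin n → K) (χ : K → ZMod 2) (a : Flag n N) (j : Fin n) :
    rfs N β χ (PP a j) + rfs N β χ (PP a (j + 1)) = χ (β (a.2 j)) * Dl β a j := by
  unfold rfs
  rw [← sum_add_distrib, Finset.sum_eq_single (β (a.2 j))]
  · rw [Dl, mul_add]
  · intro b _ hb
    have : rf N β b (PP a (j + 1)) = rf N β b (PP a j) := by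
      apply rf_congr
      intro k hk
      have : k ≠ a.2 j := by rintro rfl; exact hb hk.symm
      rw [PP_succ_ne a j k this]; simp
    rw [this]; exact z2_self _
  · simp

lemma Dl_one (β : Fin n → K) (a : Flag n N) (j : Fin n) (h : Dl β a j = 1) :
    |vt (a.1 (a.2 j))| = 2 * N ∧ ∀ k' < a.2 j, β k' = β (a.2 j) → |PP a j k'| ≠ 2 * N := by
  have hj : PP a j (a.2 j) = vt (a.1 (a.2 j)) := by simp [PP]
  have hj' : PP a (j + 1) (a.2 j) = md (a.1 (a.2 j)) := by simp [PP]
  have hmd := md_abs (a.1 (a.2 j))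
  have h1 : |vt (a.1 (a.2 j))| = 2 * N := by
    by_contra hc
    have : rf N β (β (a.2 j)) (PP a (j + 1)) = rf N β (β (a.2 j)) (PP a j) := by
      apply rf_congr
      intro k hk
      by_cases hkj : k = a.2 j
      · rw [hkj, hj, hj']
        have : md (a.1 (a.2 j)) ≠ 2 * N := fun h => by rw [h] at hmd; simp at hmd
        have h2 : vt (a.1 (a.2 j)) ≠ 2 * N := fun h => by rw [h] at hc; simp at hc
        simp [hc, this, h2, hmd.ne]
      · rw [PP_succ_ne a j k hkj]; simp
    rw [Dl, this, z2_self] at h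
    exact absurd h (by decide)
  refine ⟨h1, ?_⟩
  intro k' hk' hb hc
  obtain ⟨l, hl0, hl1, hl2, hl3⟩ := exists_first β (β (a.2 j)) (PP a j) k' hb hc
  have e : ∀ k ≤ l, PP a (j + 1) k = PP a j k := fun k hk =>
    PP_succ_ne a j k (ne_of_lt (lt_of_le_of_lt hk (lt_of_le_of_lt hl0 hk')))
  rw [Dl, rf_first _ _ _ l hl1 hl2 hl3, rf_first _ _ (PP a (j + 1)) l hl1 (by rw [e l le_rfl, hl2])
    (fun k hk => by rw [e k hk.le]; exact hl3 k hk), e l le_rfl, z2_self] at h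
  exact absurd h (by decide)

def Shuf (β : Fin n → K) (π : Perm (Fin n)) : Prop :=
  ∀ k k', k < k' → β k = β k' → π.symm k < π.symm k'

lemma Dl_all (β : Fin n → K) (a : Flag n N) (h : ∀ j, Dl β a j = 1) :
    Shuf β a.2 ∧ ∀ k, |vt (a.1 k)| = 2 * N := by
  have h1 : ∀ k, |vt (a.1 k)| = 2 * N := by
    intro k
    simpa using (Dl_one β a (a.2.symm k) (h _)).1
  refine ⟨?_, h1⟩
  intro k k' hk hb
  have := (Dl_one β a (a.2.symm k') (h _)).2 k (by simpa using hk) (by simpa using hb)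
  by_contra hc
  apply this
  have : ¬ ((a.2.symm k : Fin n) : ℕ) < (a.2.symm k' : Fin n) := fun h => hc h
  simp only [PP, this, if_false, h1]

def cn (β : Fin n → K) (k : Fin n) : ℕ := #{k' | k < k' ∧ β k' = β k}

def sg (a : Flag n N) (k : Fin n) : ZMod 2 := if vt (a.1 k) = 2 * N then 1 else 0

lemma Dl_eq (β : Fin n → K) (a : Flag n N) (hs : Shuf β a.2) (hv : ∀ k, |vt (a.1 k)| = 2 * N)
    (k : Fin n) :
    (cn β k = 0 ∧ Dl β a (a.2.symm k) = sg a k) ∨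
    ∃ k' > k, cn β k = cn β k' + 1 ∧ Dl β a (a.2.symm k) = sg a k + sg a k' := by
  have hmd : ∀ k, |md (a.1 k)| ≠ 2 * N := fun k => (md_abs (a.1 k)).ne
  have h1 : rf N β (β k) (PP a (a.2.symm k)) = sg a k := by
    have : PP a (a.2.symm k) k = vt (a.1 k) := by simp [PP]
    rw [rf_first _ _ _ k rfl (by rw [this, hv]), this, sg]
    intro k' hk' hb
    have : ((a.2.symm k' : Fin n) : ℕ) < (a.2.symm k : Fin n) := hs k' k hk' hb
    simp only [PP, this, if_true]
    exact hmd _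
  have hle : ∀ k' ≤ k, β k' = β k → |PP a ((a.2.symm k : Fin n) + 1) k'| ≠ 2 * N := by
    intro k' hk' hb
    have : ((a.2.symm k' : Fin n) : ℕ) < (a.2.symm k : Fin n) + 1 := by
      rcases hk'.eq_or_lt with h | h
      · rw [h]; omega
      · have : ((a.2.symm k' : Fin n) : ℕ) < (a.2.symm k : Fin n) := hs k' k h hb
        omega
    simp only [PP, this, if_true]
    exact hmd _
  let S : Finset (Fin n) := {k' | k < k' ∧ β k' = β k}
  have hcS : cn β k = #S := rfl
  rcases S.eq_empty_or_nonempty with hS | hS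
  · left
    refine ⟨by rw [hcS, hS]; rfl, ?_⟩
    simp only [Dl, Equiv.apply_symm_apply]
    rw [h1, rf_none, add_zero]
    intro k' hb
    apply hle k' _ hb
    by_contra hc
    have : k' ∈ S := by simp [S, hb]; exact not_le.1 hc
    rw [hS] at this; simp at this
  · right
    have hm := S.min'_mem hS
    have hmin : ∀ x ∈ S, S.min' hS ≤ x := fun x hx => S.min'_le x hx
    generalize S.min' hS = m at hm hmin
    have hm' := hm
    simp only [S, mem_filter, mem_univ, true_and] at hm
    refine ⟨m, hm.1, ?_, ?_⟩
    · rw [hcS, cn]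
      have : S = insert m (univ.filter (fun k' => m < k' ∧ β k' = β m)) := by
        ext x
        simp only [S, mem_insert, mem_filter, mem_univ, true_and]
        constructor
        · intro hx
          have := hmin x (by simp [S, hx]) 
          rcases this.eq_or_lt with h | h
          · left; exact h.symm
          · right; exact ⟨h, by rw [hx.2, hm.2]⟩
        · rintro (rfl | hx)
          · exact hm
          · exact ⟨hm.1.trans hx.1, by rw [hx.2, hm.2]⟩
      rw [this, card_insert_of_notMem]
      simp
    · simp only [Dl, Equiv.apply_symm_apply]
      have hlt : ¬ ((a.2.symm m : Fin n) : ℕ) < (a.2.symm k : Fin n) + 1 := by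
        have : ((a.2.symm k : Fin n) : ℕ) < (a.2.symm m : Fin n) := hs k m hm.1 hm.2.symm
        omega
      have hPm : PP a ((a.2.symm k : Fin n) + 1) m = vt (a.1 m) := by
        simp only [PP, hlt, if_false]
      rw [h1, rf_first _ _ (PP a ((a.2.symm k : Fin n) + 1)) m hm.2 (by rw [hPm, hv]), hPm, sg, sg]
      intro k' hk' hb
      rcases le_or_gt k' k with h | h
      · exact hle k' h hb
      · exact absurd (hmin k' (by simp [S, hb, h])) (not_le.2 hk')

lemma Dl_iff (β : Fin n → K) (a : Flag n N) (hs : Shuf β a.2) (hv : ∀ k, |vt (a.1 k)| = 2 * N) :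
    (∀ j, Dl β a j = 1) ↔ ∀ k, sg a k = cn β k + 1 := by
  have aux : ∀ x y : ZMod 2, x + y = 1 → x = y + 1 := by decide
  have aux2 : ∀ x : ZMod 2, x + 1 + 1 + (x + 1) = 1 := by decide
  constructor
  · intro h
    have key : ∀ m, ∀ k, cn β k = m → sg a k = cn β k + 1 := by
      intro m
      induction m using Nat.strong_induction_on with
      | _ m ih =>
        intro k hk
        rcases Dl_eq β a hs hv k with ⟨h1, h2⟩ | ⟨k', hk', h1, h2⟩
        · rw [h] at h2; rw [h1, ← h2]; simp
        · rw [h] at h2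
          rw [h1, aux _ _ h2.symm, ih (cn β k') (by omega) k' rfl]
          push_cast; rfl
    exact fun k => key _ k rfl
  · intro h j
    rcases Dl_eq β a hs hv (a.2 j) with ⟨h1, h2⟩ | ⟨k', hk', h1, h2⟩
    · rw [h, h1] at h2; simpa using h2
    · rw [h, h1, h] at h2
      simp only [Equiv.symm_apply_apply] at h2
      rw [h2]; push_cast; exact aux2 _

/-- the boundary half-edges -/
def bdD (hN : 0 < N) (x : ZMod 2) : HD N :=
  if x = 1 then (⟨2 * N - 1, by omega⟩, true) else (⟨0, by omega⟩, false)

lemma bdD_vt (hN : 0 < N) (x : ZMod 2) : |vt (bdD hN x)| = 2 * N ∧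
    (if vt (bdD hN x) = 2 * N then 1 else 0) = x := by
  by_cases hx : x = 1
  · have : vt (bdD hN x) = 2 * N := by
      simp [bdD, hx, vt, md]; omega
    rw [this, hx]; simp
  · have : vt (bdD hN x) = -(2 * N) := by
      simp [bdD, hx, vt, md]
    have h0 : x = 0 := (by decide : ∀ x : ZMod 2, ¬ x = 1 → x = 0) x hx
    rw [this, h0, if_neg (by omega)]; simp

lemma bdD_eq (hN : 0 < N) (d : HD N) (h : |vt d| = 2 * N) :
    d = bdD hN (if vt d = 2 * N then 1 else 0) := by
  obtain ⟨⟨a, ha⟩, b⟩ := d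
  rcases (abs_eq (by positivity : (0 : ℤ) ≤ 2 * N)).1 h with h | h
  · rw [if_pos h]
    cases b
    · simp [vt, md] at h; omega
    · simp [vt, md] at h; simp [bdD]; omega
  · rw [if_neg (by omega)]
    cases b
    · simp [vt, md] at h; simp [bdD]; omega
    · simp [vt, md] at h; omega

open Classical in
lemma sum_Dl (hN : 0 < N) (β : Fin n → K) (π : Perm (Fin n)) :
    ∑ d : Fin n → HD N, ∏ j, Dl β (d, π) j = if Shuf β π then 1 else 0 := by
  have hz : ∀ x : ZMod 2, x ≠ 1 → x = 0 := by decide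
  split_ifs with hs
  · rw [Finset.sum_eq_single (fun k => bdD hN (cn β k + 1))]
    · apply Finset.prod_eq_one
      intro j _
      refine (Dl_iff β _ hs ?_).2 ?_ j
      · intro k; exact (bdD_vt hN _).1
      · intro k; exact (bdD_vt hN _).2
    · intro d _ hd
      by_contra hc
      apply hd
      have h1 : ∀ j, Dl β (d, π) j = 1 := by
        intro j
        by_contra hj
        exact hc (Finset.prod_eq_zero (mem_univ j) (hz _ hj))
      have h2 := Dl_all β _ h1
      have h3 := (Dl_iff β _ h2.1 h2.2).1 h1
      funext k
      rw [bdD_eq hN (d k) (h2.2 k)]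
      congr 1
      exact h3 k
    · simp
  · apply Finset.sum_eq_zero
    intro d _
    by_contra hc
    apply hs
    refine (Dl_all β (d, π) (fun j => ?_)).1
    by_contra hj
    exact hc (Finset.prod_eq_zero (mem_univ j) (hz _ hj))

open Classical in
lemma sum_ref (hN : 0 < N) (β : Fin n → K) (χ : ℕ → K → ZMod 2) :
    ∑ a : Flag n N, ∏ j ∈ range n, rfs N β (χ j) (PP a j) =
      ∑ π : Perm (Fin n), if Shuf β π then ∏ j : Fin n, χ j (β (π j)) else 0 := by
  rw [← sum_expand (fun j => rfs N β (χ j))]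
  simp only [Finset.prod_range, rfs_diff, prod_mul_distrib]
  rw [Fintype.sum_prod_type, Finset.sum_comm]
  refine Finset.sum_congr rfl (fun π _ => ?_)
  dsimp only
  rw [← Finset.mul_sum, sum_Dl hN]
  simp

end ref


def ct {n : ℕ} {K : Type*} [DecidableEq K] (w : Fin n → K) (b : K) : ℕ :=
  ∑ j, if w j = b then 1 else 0

lemma exists_perm_of_ct {n : ℕ} {K : Type*} [DecidableEq K] (w β : Fin n → K)
    (h : ct w = ct β) : ∃ σ : Perm (Fin n), w ∘ σ = β := by
  have e : ∀ b, Nonempty ({a // β a = b} ≃ {a // w a = b}) := by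
    intro b
    rw [← Fintype.card_eq]
    have := congrFun h b
    simp only [ct, Finset.sum_boole] at this
    rw [Fintype.card_subtype, Fintype.card_subtype]
    exact_mod_cast this.symm
  have e := fun b => Classical.choice (e b)
  refine ⟨Equiv.ofFiberEquiv e, ?_⟩
  funext a
  exact Equiv.ofFiberEquiv_map e a

lemma ct_comp {n : ℕ} {K : Type*} [DecidableEq K] (w : Fin n → K) (σ : Perm (Fin n)) :
    ct (w ∘ σ) = ct w := by
  funext b
  exact Equiv.sum_comp σ (fun j => if w j = b then 1 else 0)

open Classical in
lemma shuf_words {n : ℕ} {K : Type*} [LinearOrder K] [Fintype K] (β : Fin n → K)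
    (hβ : Monotone β) (f : (Fin n → K) → ZMod 2) :
    (∑ π : Perm (Fin n), if Shuf β π then f (β ∘ π) else 0) =
      ∑ w : Fin n → K, if ct w = ct β then f w else 0 := by
  rw [← Finset.sum_filter, ← Finset.sum_filter]
  refine Finset.sum_bij' (fun π _ => β ∘ π) (fun w _ => (Tuple.sort w).symm) ?_ ?_ ?_ ?_ ?_
  · intro π hπ
    simp [ct_comp]
  · intro w hw
    simp only [mem_filter, mem_univ, true_and] at hw ⊢
    obtain ⟨σ, hσ⟩ := exists_perm_of_ct w β hw
    have h1 : w ∘ Tuple.sort w = β := by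
      rw [← hσ]; symm
      rw [Tuple.comp_sort_eq_comp_iff_monotone, hσ]; exact hβ
    have h2 := (Tuple.eq_sort_iff (f := w) (σ := Tuple.sort w)).1 rfl
    intro k k' hk hb
    simp only [Equiv.symm_symm]
    apply h2.2 k k' hk
    have := congrFun h1
    simp only [Function.comp] at this
    rw [this, this]; exact hb
  · intro π hπ
    simp only [mem_filter, mem_univ, true_and] at hπ
    have : π.symm = Tuple.sort (β ∘ π) := by
      rw [Tuple.eq_sort_iff]
      constructor
      · have : (β ∘ π) ∘ π.symm = β := by funext k; simp
        rw [this]; exact hβ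
      · intro i j hij h
        apply hπ i j hij
        simpa using h
    rw [← this]; rfl
  · intro w hw
    simp only [mem_filter, mem_univ, true_and] at hw ⊢
    obtain ⟨σ, hσ⟩ := exists_perm_of_ct w β hw
    have h1 : w ∘ Tuple.sort w = β := by
      rw [← hσ]; symm
      rw [Tuple.comp_sort_eq_comp_iff_monotone, hσ]; exact hβ
    rw [← h1]
    funext k
    simp
  · intro π hπ
    rfl

/-- The number mod 2 of words. -/
def WW (χ : ℕ → Fin 3 → ZMod 2) (n : ℕ) (a b c : ℕ) : ZMod 2 :=
  ∑ w : Fin n → Fin 3, if ct w 0 = a ∧ ct w 1 = b ∧ ct w 2 = c then ∏ j : Fin n, χ j (w j) else 0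

lemma ct_snoc {n : ℕ} (w : Fin n → Fin 3) (x b : Fin 3) :
    ct (Fin.snoc w x : Fin (n + 1) → Fin 3) b = ct w b + if x = b then 1 else 0 := by
  simp only [ct, Fin.sum_univ_castSucc, Fin.snoc_castSucc, Fin.snoc_last]

lemma WW_succ (χ : ℕ → Fin 3 → ZMod 2) (n : ℕ) (a b c : ℕ) :
    WW χ (n + 1) a b c = (if 1 ≤ a then χ n 0 * WW χ n (a - 1) b c else 0)
      + (if 1 ≤ b then χ n 1 * WW χ n a (b - 1) c else 0)
      + (if 1 ≤ c then χ n 2 * WW χ n a b (c - 1) else 0) := by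
  have h : WW χ (n + 1) a b c = ∑ x : Fin 3, ∑ w : Fin n → Fin 3,
      if ct w 0 + (if x = 0 then 1 else 0) = a ∧ ct w 1 + (if x = 1 then 1 else 0) = b
        ∧ ct w 2 + (if x = 2 then 1 else 0) = c then (∏ j : Fin n, χ j (w j)) * χ n x else 0 := by
    unfold WW
    rw [← (Fin.snocEquiv (fun _ : Fin (n + 1) => Fin 3)).sum_comp, Fintype.sum_prod_type]
    refine Finset.sum_congr rfl (fun x _ => Finset.sum_congr rfl (fun w _ => ?_))
    have e : (Fin.snocEquiv (fun _ : Fin (n + 1) => Fin 3)) (x, w) = Fin.snoc w x := rfl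
    rw [e]
    simp only [ct_snoc, Fin.prod_univ_castSucc, Fin.snoc_castSucc, Fin.snoc_last, Fin.val_castSucc,
      Fin.val_last]
  rw [h, Fin.sum_univ_three]
  congr 1
  · congr 1
    · by_cases ha : 1 ≤ a
      · rw [if_pos ha, WW, mul_sum]
        refine Finset.sum_congr rfl (fun w _ => ?_)
        have : ct w 0 + 1 = a ↔ ct w 0 = a - 1 := by omega
        simp [this, mul_comm]
      · rw [if_neg ha]; apply Finset.sum_eq_zero
        intro w _
        rw [if_neg]; simp; omega
    · by_cases ha : 1 ≤ b
      · rw [if_pos ha, WW, mul_sum]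
        refine Finset.sum_congr rfl (fun w _ => ?_)
        have : ct w 1 + 1 = b ↔ ct w 1 = b - 1 := by omega
        simp [this, mul_comm]
      · rw [if_neg ha]; apply Finset.sum_eq_zero
        intro w _
        rw [if_neg]; simp; omega
  · by_cases ha : 1 ≤ c
    · rw [if_pos ha, WW, mul_sum]
      refine Finset.sum_congr rfl (fun w _ => ?_)
      have : ct w 2 + 1 = c ↔ ct w 2 = c - 1 := by omega
      simp [this, mul_comm]
    · rw [if_neg ha]; apply Finset.sum_eq_zero
      intro w _
      rw [if_neg]; simp; omega

lemma WW_big (χ : ℕ → Fin 3 → ZMod 2) (n : ℕ) (a b c : ℕ) (h : n < a ∨ n < b ∨ n < c) :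
    WW χ n a b c = 0 := by
  have hc : ∀ (w : Fin n → Fin 3) x, ct w x ≤ n := by
    intro w x
    calc ct w x ≤ ∑ j : Fin n, 1 := Finset.sum_le_sum (fun j _ => by split_ifs <;> simp)
      _ = n := by simp
  apply Finset.sum_eq_zero
  intro w _
  rw [if_neg]
  have := hc w 0; have := hc w 1; have := hc w 2
  omega

lemma WW_zero (χ : ℕ → Fin 3 → ZMod 2) (a b c : ℕ) :
    WW χ 0 a b c = if a = 0 ∧ b = 0 ∧ c = 0 then 1 else 0 := by
  simp [WW, ct, eq_comm]

/-- bit-packed dynamic programming -/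
def BB (m : ℕ → Fin 3 → Bool) : ℕ → ℕ
  | 0 => 1
  | n + 1 => ((bif m n 0 then BB m n <<< 1 else 0) ^^^ (bif m n 1 then BB m n <<< 64 else 0)) ^^^
      (bif m n 2 then BB m n <<< 4096 else 0)

lemma BB_spec (m : ℕ → Fin 3 → Bool) (n : ℕ) (hn : n < 63) : ∀ a b c, a < 64 → b < 64 →
    (if (BB m n).testBit (a + 64 * b + 4096 * c) then 1 else 0) =
      WW (fun j x => if m j x then 1 else 0) n a b c := by
  induction n with
  | zero =>
    intro a b c ha hb
    rw [WW_zero]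
    congr 1
    simp only [BB, Nat.testBit_one_eq_true_iff_self_eq_zero]
    apply propext; omega
  | succ n ih =>
    intro a b c ha hb
    have hx : ∀ p q : Bool, (if (p ^^ q) = true then (1 : ZMod 2) else 0) =
      (if p = true then 1 else 0) + (if q = true then 1 else 0) := by decide
    rw [WW_succ, BB, Nat.testBit_xor, Nat.testBit_xor, hx, hx]
    congr 1
    · congr 1
      · cases h : m n 0
        · simp
        · simp only [cond_true, Nat.testBit_shiftLeft, if_true, one_mul]
          by_cases h1 : 1 ≤ a
          · rw [if_pos h1, ← ih (by omega) (a - 1) b c (by omega) hb]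
            have : a + 64 * b + 4096 * c - 1 = a - 1 + 64 * b + 4096 * c := by omega
            have h2 : a + 64 * b + 4096 * c ≥ 1 := by omega
            simp [this, h2]
          · rw [if_neg h1]
            have ha0 : a = 0 := by omega
            subst ha0
            by_cases h2 : 1 ≤ b
            · have := ih (by omega) 63 (b - 1) c (by omega) (by omega)
              rw [WW_big _ _ _ _ _ (by omega)] at this
              have e : 0 + 64 * b + 4096 * c - 1 = 63 + 64 * (b - 1) + 4096 * c := by omega
              rw [e]; simp at this; simp [this]
            · by_cases h3 : 1 ≤ c
              · have := ih (by omega) 63 63 (c - 1) (by omega) (by omega)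
                rw [WW_big _ _ _ _ _ (by omega)] at this
                have e : 0 + 64 * b + 4096 * c - 1 = 63 + 64 * 63 + 4096 * (c - 1) := by omega
                rw [e]; simp at this; simp [this]
              · have : ¬ (0 + 64 * b + 4096 * c ≥ 1) := by omega
                simp only [this, decide_false, Bool.false_and]; simp
      · cases h : m n 1
        · simp
        · simp only [cond_true, Nat.testBit_shiftLeft, if_true, one_mul]
          by_cases h1 : 1 ≤ b
          · rw [if_pos h1, ← ih (by omega) a (b - 1) c (by omega) (by omega)]
            have : a + 64 * b + 4096 * c - 64 = a + 64 * (b - 1) + 4096 * c := by omega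
            have h2 : a + 64 * b + 4096 * c ≥ 64 := by omega
            simp [this, h2]
          · rw [if_neg h1]
            have hb0 : b = 0 := by omega
            subst hb0
            by_cases h3 : 1 ≤ c
            · have := ih (by omega) a 63 (c - 1) (by omega) (by omega)
              rw [WW_big _ _ _ _ _ (by omega)] at this
              have e : a + 64 * 0 + 4096 * c - 64 = a + 64 * 63 + 4096 * (c - 1) := by omega
              rw [e]; simp at this; simp [this]
            · have : ¬ (a + 64 * 0 + 4096 * c ≥ 64) := by omega
              simp only [this, decide_false, Bool.false_and]; simp
    · cases h : m n 2
      · simp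
      · simp only [cond_true, Nat.testBit_shiftLeft, if_true, one_mul]
        by_cases h1 : 1 ≤ c
        · rw [if_pos h1, ← ih (by omega) a b (c - 1) (by omega) (by omega)]
          have : a + 64 * b + 4096 * c - 4096 = a + 64 * b + 4096 * (c - 1) := by omega
          have h2 : a + 64 * b + 4096 * c ≥ 4096 := by omega
          simp [this, h2]
        · rw [if_neg h1]
          have : ¬ (a + 64 * b + 4096 * c ≥ 4096) := by omega
          simp [this]

/-- characters: bit 0 = `u`, bit 1 = `v`, bit 2 = `w` -/
def mask (j : ℕ) (x : Fin 3) : Bool :=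
  match x with
  | 0 => decide (8 ≤ j % 15)
  | 1 => decide (j / 15 ≠ 1)
  | 2 => decide (1 ≤ j / 15)

def blk (k : Fin 45) : Fin 3 := if (k : ℕ) < 15 then 0 else if (k : ℕ) < 31 then 1 else 2

lemma blk_mono : Monotone blk := by
  unfold Monotone; decide

lemma WW_val : WW (fun j x => if mask j x then 1 else 0) 45 15 16 14 = 1 := by
  rw [← BB_spec mask 45 (by norm_num) 15 16 14 (by norm_num) (by norm_num)]
  rw [if_pos]
  decide +kernel

lemma words_val : (∑ π : Perm (Fin 45), open Classical in
    if Shuf blk π then ∏ j : Fin 45, (if mask j (blk (π j)) then (1 : ZMod 2) else 0) else 0) = 1 := by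
  have := shuf_words blk blk_mono
    (fun w => ∏ j : Fin 45, (if mask j (w j) then (1 : ZMod 2) else 0))
  simp only [Function.comp] at this
  rw [this]
  refine Eq.trans ?_ WW_val
  rw [WW]
  have h0 : ct blk 0 = 15 := by decide +kernel
  have h1 : ct blk 1 = 16 := by decide +kernel
  have h2 : ct blk 2 = 14 := by decide +kernel
  have hiff : ∀ w : Fin 45 → Fin 3, ct w = ct blk ↔ ct w 0 = 15 ∧ ct w 1 = 16 ∧ ct w 2 = 14 := by
    intro w
    constructor
    · intro h
      rw [h]
      exact ⟨h0, h1, h2⟩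
    · rintro ⟨g0, g1, g2⟩
      funext b
      fin_cases b
      · exact g0.trans h0.symm
      · exact g1.trans h1.symm
      · exact g2.trans h2.symm
  apply Fintype.sum_congr
  intro w
  exact if_congr (hiff w) rfl rfl

lemma PP_close {n N : ℕ} (a : Flag n N) (i : ℕ) (k : Fin n) : |PP a i k - PP a 0 k| ≤ 1 := by
  have : |md (a.1 k) - vt (a.1 k)| ≤ 1 := by
    unfold vt; split_ifs <;> simp
  unfold PP
  split_ifs <;> simp_all

theorem topo (F : (Fin 45 → ℝ) → Fin 45 → ℝ) (hF : Continuous F)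
    (heq : ∀ x : Fin 45 → ℝ, (∀ k, |x k| ≤ 1) → ∀ k, |x k| = 1 → ∀ j : Fin 45,
      F (fun l => if blk l = blk k then - x l else x l) j =
        (if mask j (blk k) then -1 else 1) * F x j) :
    ∃ x : Fin 45 → ℝ, (∀ k, |x k| ≤ 1) ∧ ∀ j, F x j = 0 := by
  by_contra hcon
  push Not at hcon
  let C : Set (Fin 45 → ℝ) := Set.Icc (fun _ => -1) (fun _ => 1)
  have hC : IsCompact C := isCompact_Icc
  have hmem : ∀ x, x ∈ C ↔ ∀ k, |x k| ≤ 1 := by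
    intro x
    simp only [C, Set.mem_Icc, Pi.le_def, abs_le]
    exact ⟨fun h k => ⟨h.1 k, h.2 k⟩, fun h => ⟨fun k => (h k).1, fun k => (h k).2⟩⟩
  obtain ⟨x0, hx0, hmin⟩ := hC.exists_isMinOn ⟨fun _ => 0, by rw [hmem]; simp⟩
    (hF.norm.continuousOn)
  set ε := ‖F x0‖ with hε
  have hεpos : 0 < ε := by
    rw [hε, norm_pos_iff]
    intro h
    obtain ⟨j, hj⟩ := hcon x0 ((hmem _).1 hx0)
    apply hj; rw [h]; rfl
  have huc := hC.uniformContinuousOn_of_continuous hF.continuousOn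
  rw [Metric.uniformContinuousOn_iff] at huc
  obtain ⟨δ, hδ, huc⟩ := huc ε hεpos
  obtain ⟨N, hN⟩ := exists_nat_gt (1 / δ)
  have hNpos : 0 < N := by
    have : 0 < 1 / δ := by positivity
    have : (0 : ℝ) < N := this.trans hN
    exact_mod_cast this
  have hNR : (0 : ℝ) < N := by exact_mod_cast hNpos
  have hNδ : 1 / (2 * N : ℝ) < δ := by
    rw [div_lt_iff₀ (by positivity)]
    rw [div_lt_iff₀ hδ] at hN
    nlinarith
  let X : (Fin 45 → ℤ) → Fin 45 → ℝ := fun p k => (p k : ℝ) / (2 * N)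
  have hX : ∀ p : Fin 45 → ℤ, (∀ k, |p k| ≤ 2 * N) → ∀ k, |X p k| ≤ 1 := by
    intro p hp k
    have : |(p k : ℝ)| ≤ 2 * N := by exact_mod_cast hp k
    simp only [X]
    rw [abs_div, abs_of_pos (by positivity : (0 : ℝ) < 2 * N), div_le_one (by positivity)]
    exact this
  let χ : ℕ → Fin 3 → ZMod 2 := fun j b => if mask j b then 1 else 0
  let s : ℕ → (Fin 45 → ℤ) → ZMod 2 := fun j p =>
    if h : j < 45 then
      (if F (X p) ⟨j, h⟩ = 0 then rfs N blk (χ j) p else if F (X p) ⟨j, h⟩ < 0 then 1 else 0)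
    else rfs N blk (χ j) p
  have hs : ∀ j, EqV N blk (χ j) (s j) := by
    intro j
    by_cases hj : j < 45
    · intro p hp k hk
      have h1 := heq (X p) (hX p hp) k (by
        have : |(p k : ℝ)| = 2 * N := by exact_mod_cast hk
        simp only [X]
        rw [abs_div, abs_of_pos (by positivity : (0 : ℝ) < 2 * N), this, div_self (by positivity)])
        ⟨j, hj⟩
      have h2 : (fun l => if blk l = blk k then - X p l else X p l) = X (ng blk (blk k) p) := by
        funext l
        simp only [X, ng]
        split_ifs
        · push_cast; ring
        · rfl
      rw [h2] at h1
      have h3 := rfs_EqV hNpos blk (χ j) p hp k hk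
      simp only [s, hj, dif_pos]
      rw [h1, h3]
      generalize F (X p) ⟨j, hj⟩ = y
      simp only [χ]
      cases hm : mask j (blk k)
      · simp
      · simp only [if_true]
        rcases lt_trichotomy y 0 with h | h | h
        · have : ¬ (-1 * y < 0) := by linarith
          simp [h, h.ne]
          rw [if_neg (by linarith)]; decide
        · simp [h]
        · simp [h, h.ne', h.not_gt]
    · simp only [s, hj, dif_neg, not_false_eq_true]
      exact rfs_EqV hNpos blk (χ j)
  have e1 := sum_indep blk s (fun j => rfs N blk (χ j)) χ hs (fun j => rfs_EqV hNpos blk (χ j))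
  have e3 := sum_ref hNpos blk χ
  rw [words_val] at e3
  have e4 := ((sum_expand (n := 45) (N := N) s).trans e1).trans e3
  clear e1 e3
  have e2 : ∑ a : Flag 45 N, (∏ j ∈ range 45, (s j (PP a j) + s j (PP a (j + 1)))) = 0 := by
    apply Finset.sum_eq_zero
    intro a _
    have hin : ∀ i, X (PP a i) ∈ C := fun i => (hmem _).2 (hX _ (PP_abs a i))
    have h0 : ε ≤ ‖F (X (PP a 0))‖ := hmin (hin 0)
    obtain ⟨j, hj⟩ : ∃ j, ε ≤ |F (X (PP a 0)) j| := by
      by_contra hc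
      push Not at hc
      exact absurd ((pi_norm_lt_iff hεpos).2 hc) (not_lt.2 h0)
    have hclose : ∀ i, |F (X (PP a i)) j - F (X (PP a 0)) j| < ε := by
      intro i
      have h1 : dist (X (PP a i)) (X (PP a 0)) < δ := by
        refine lt_of_le_of_lt ?_ hNδ
        rw [dist_pi_le_iff (by positivity)]
        intro k
        have : |(PP a i k : ℝ) - PP a 0 k| ≤ 1 := by exact_mod_cast PP_close a i k
        simp only [X, Real.dist_eq]
        rw [← sub_div, abs_div, abs_of_pos (by positivity : (0 : ℝ) < 2 * N)]
        gcongr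
      have h2 := huc _ (hin i) _ (hin 0) h1
      refine lt_of_le_of_lt ?_ h2
      rw [← Real.dist_eq]
      exact dist_le_pi_dist _ _ j
    have hsame : ∀ i, s j (PP a i) = s j (PP a 0) := by
      intro i
      have h1 := abs_lt.1 (hclose i)
      have hj2 := j.2
      simp only [s, hj2, dif_pos, Fin.eta]
      rcases le_abs.1 hj with h | h
      · have a1 : 0 < F (X (PP a 0)) j := by linarith
        have a2 : 0 < F (X (PP a i)) j := by linarith
        simp [a1.ne', a2.ne', a1.not_gt, a2.not_gt]
      · have a1 : F (X (PP a 0)) j < 0 := by linarith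
        have a2 : F (X (PP a i)) j < 0 := by linarith
        simp [a1.ne, a2.ne, a1, a2]
    have hz : s j (PP a j) + s j (PP a (j + 1)) = 0 := by
      rw [hsame j, hsame (j + 1)]
      exact z2_self _
    clear_value s
    exact Finset.prod_eq_zero (i := (j : ℕ)) (Finset.mem_range.2 j.2) hz
  have e5 := e2.symm.trans e4
  exact zero_ne_one e5

end Equi

namespace EquiM

/-- the ambient space -/
abbrev ES := EuclideanSpace ℝ (Fin 16)

noncomputable def th (r : ℝ) : ℝ := if 0 < r then 1 else 0

noncomputable def sg (r : ℝ) : ℝ := if 0 < r then 1 else if r < 0 then -1 else 0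

lemma th_meas : Measurable th := by
  unfold th
  exact Measurable.ite measurableSet_Ioi measurable_const measurable_const

lemma sg_meas : Measurable sg := by
  unfold sg
  exact Measurable.ite measurableSet_Ioi measurable_const
    (Measurable.ite measurableSet_Iio measurable_const measurable_const)

lemma th_abs (r : ℝ) : |th r| ≤ 1 := by
  unfold th; split_ifs <;> simp

lemma sg_abs (r : ℝ) : |sg r| ≤ 1 := by
  unfold sg; split_ifs <;> simp

lemma sg_neg (r : ℝ) : sg (-r) = - sg r := by
  unfold sg
  rcases lt_trichotomy r 0 with h | h | h
  · simp [h, h.not_gt]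
  · simp [h]
  · simp [h, h.not_gt]

lemma th_cont {r : ℝ} (h : r ≠ 0) : ContinuousAt th r := by
  rcases lt_or_gt_of_ne h with h | h
  · have : th =ᶠ[nhds r] fun _ => 0 := by
      filter_upwards [Iio_mem_nhds h] with y hy
      have : ¬ 0 < y := not_lt.2 (le_of_lt hy)
      simp [th, this]
    exact continuousAt_const.congr this.symm
  · have : th =ᶠ[nhds r] fun _ => 1 := by
      filter_upwards [Ioi_mem_nhds h] with y hy
      have : 0 < y := hy
      simp [th, this]
    exact continuousAt_const.congr this.symm

lemma sg_eq (r : ℝ) : sg r = th r - th (-r) := by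
  unfold sg th
  rcases lt_trichotomy r 0 with h | h | h
  · simp [h, h.not_gt]
  · simp [h]
  · simp [h, h.not_gt]

lemma sg_cont {r : ℝ} (h : r ≠ 0) : ContinuousAt sg r := by
  have : sg = fun r => th r - th (-r) := funext sg_eq
  rw [this]
  refine (th_cont h).sub ?_
  exact ContinuousAt.comp (g := th) (f := fun r : ℝ => -r) (th_cont (neg_ne_zero.2 h))
    continuous_neg.continuousAt

lemma th_add {r : ℝ} (h : r ≠ 0) : th r + th (-r) = 1 := by
  unfold th
  rcases lt_or_gt_of_ne h with h | h
  · simp [h, h.not_gt]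
  · simp [h, h.not_gt]

lemma cont_int {α : Type*} [TopologicalSpace α] [FirstCountableTopology α]
    (μ : Measure ES) [IsFiniteMeasure μ] (h : α → ES → ℝ) (a0 : α)
    (hm : ∀ a, Measurable (h a)) (hb : ∀ a x, |h a x| ≤ 1)
    (hc : ∀ᵐ x ∂μ, ContinuousAt (fun a => h a x) a0) :
    ContinuousAt (fun a => ∫ x, h a x ∂μ) a0 := by
  apply continuousAt_of_dominated (bound := fun _ => 1)
  · exact Filter.Eventually.of_forall fun a => (hm a).aestronglyMeasurable
  · exact Filter.Eventually.of_forall fun a => Filter.Eventually.of_forall fun x => hb a x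
  · exact integrable_const _
  · exact hc

lemma int_bdd (μ : Measure ES) [IsFiniteMeasure μ] (h : ES → ℝ)
    (hm : Measurable h) (hb : ∀ x, |h x| ≤ 1) : Integrable h μ :=
  (integrable_const (1 : ℝ)).mono' hm.aestronglyMeasurable (Filter.Eventually.of_forall hb)

lemma hyper_null (μ : Measure ES) (hac : μ ≪ volume) (v : ES) (s : ℝ) (h : v ≠ 0 ∨ s ≠ 0) :
    ∀ᵐ x ∂μ, (inner ℝ x v : ℝ) ≠ s := by
  refine hac.ae_le ?_
  show ∀ᵐ x ∂(volume : Measure ES), (inner ℝ x v : ℝ) ≠ s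
  rw [ae_iff]
  simp only [ne_eq, not_not]
  by_cases hv : v = 0
  · have hs : s ≠ 0 := by simpa [hv] using h
    have : {x : ES | (inner ℝ x v : ℝ) = s} = ∅ := by
      ext x; simp [hv, hs.symm]
    rw [this]; simp
  · by_cases hne : ∃ x0 : ES, (inner ℝ x0 v : ℝ) = s
    · obtain ⟨x0, hx0⟩ := hne
      have hk : (AffineSubspace.mk' x0 (LinearMap.ker (innerₗ ES v))) ≠ ⊤ := by
        intro ht
        have : x0 + v ∈ AffineSubspace.mk' x0 (LinearMap.ker (innerₗ ES v)) := by
          rw [ht]; trivial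
        rw [AffineSubspace.mem_mk'] at this
        simp [hv] at this
      have h0 := Measure.addHaar_affineSubspace (volume : Measure ES) _ hk
      refine measure_mono_null ?_ h0
      intro x hx
      have hx' : (inner ℝ x v : ℝ) = s := hx
      rw [SetLike.mem_coe, AffineSubspace.mem_mk']
      simp only [vsub_eq_sub, LinearMap.mem_ker, innerₗ_apply_apply, inner_sub_right]
      rw [real_inner_comm, hx', real_inner_comm, hx0, sub_self]
    · have : {x : ES | (inner ℝ x v : ℝ) = s} = ∅ := by
        ext x; simp only [Set.mem_ofPred_eq, Set.mem_empty_iff_false, iff_false]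
        exact fun hx => hne ⟨x, hx⟩
      rw [this]; simp

/-- distribution function -/
noncomputable def GG (μ : Measure ES) (u : ES) (t : ℝ) : ℝ := ∫ x, th (t - inner ℝ x u) ∂μ

lemma inner_meas (u : ES) : Measurable fun x : ES => (inner ℝ x u : ℝ) :=
  (continuous_id.inner continuous_const).measurable

lemma GG_meas (u : ES) (t : ℝ) : Measurable fun x : ES => th (t - inner ℝ x u) :=
  th_meas.comp (measurable_const.sub (inner_meas u))

lemma GG_cont_u (μ : Measure ES) [IsFiniteMeasure μ] (hac : μ ≪ volume) (u : ES) (hu : u ≠ 0)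
    (t : ℝ) : ContinuousAt (fun u => GG μ u t) u := by
  apply cont_int
  · intro a; exact GG_meas a t
  · intro a x; exact th_abs _
  · filter_upwards [hyper_null μ hac u t (Or.inl hu)] with x hx
    refine ContinuousAt.comp (g := th) (f := fun a : ES => t - inner ℝ x a) (th_cont ?_) ?_
    · exact sub_ne_zero.2 hx.symm
    · fun_prop

lemma GG_cont_t (μ : Measure ES) [IsFiniteMeasure μ] (hac : μ ≪ volume) (u : ES) (hu : u ≠ 0) :
    Continuous (fun t => GG μ u t) := by
  rw [continuous_iff_continuousAt]
  intro t
  apply cont_int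
  · intro a; exact GG_meas u a
  · intro a x; exact th_abs _
  · filter_upwards [hyper_null μ hac u t (Or.inl hu)] with x hx
    refine ContinuousAt.comp (g := th) (f := fun a : ℝ => a - inner ℝ x u) (th_cont ?_) ?_
    · exact sub_ne_zero.2 hx.symm
    · fun_prop

lemma GG_neg (μ : Measure ES) [IsFiniteMeasure μ] (hac : μ ≪ volume) (u : ES) (hu : u ≠ 0)
    (t : ℝ) : GG μ (-u) (-t) = μ.real Set.univ - GG μ u t := by
  unfold GG
  have : μ.real Set.univ = ∫ _, (1 : ℝ) ∂μ := by simp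
  rw [this, ← integral_sub (integrable_const _) (int_bdd μ _ (GG_meas u t) fun x => th_abs _)]
  apply integral_congr_ae
  filter_upwards [hyper_null μ hac u t (Or.inl hu)] with x hx
  have := th_add (sub_ne_zero.2 hx.symm)
  rw [← this]
  simp only [inner_neg_right]
  rw [add_sub_cancel_left]
  congr 1; ring

lemma GG_top (μ : Measure ES) [IsFiniteMeasure μ] (u : ES) :
    Filter.Tendsto (fun t => GG μ u t) Filter.atTop (nhds (μ.real Set.univ)) := by
  have h1 : μ.real Set.univ = ∫ _, (1 : ℝ) ∂μ := by simp
  rw [h1]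
  apply tendsto_integral_filter_of_dominated_convergence (bound := fun _ => 1)
  · exact Filter.Eventually.of_forall fun a => (GG_meas u a).aestronglyMeasurable
  · exact Filter.Eventually.of_forall fun a => Filter.Eventually.of_forall fun x => th_abs _
  · exact integrable_const _
  · refine Filter.Eventually.of_forall fun x => ?_
    apply tendsto_const_nhds.congr'
    filter_upwards [Filter.eventually_gt_atTop (inner ℝ x u : ℝ)] with t ht
    simp [th, ht]

lemma GG_bot (μ : Measure ES) [IsFiniteMeasure μ] (u : ES) :
    Filter.Tendsto (fun t => GG μ u t) Filter.atBot (nhds 0) := by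
  have h1 : (0 : ℝ) = ∫ _, (0 : ℝ) ∂μ := by simp
  rw [h1]
  apply tendsto_integral_filter_of_dominated_convergence (bound := fun _ => 1)
  · exact Filter.Eventually.of_forall fun a => (GG_meas u a).aestronglyMeasurable
  · exact Filter.Eventually.of_forall fun a => Filter.Eventually.of_forall fun x => th_abs _
  · exact integrable_const _
  · refine Filter.Eventually.of_forall fun x => ?_
    apply tendsto_const_nhds.congr'
    filter_upwards [Filter.eventually_lt_atBot (inner ℝ x u : ℝ)] with t ht
    simp [th, ht.le]

lemma GG_mono (μ : Measure ES) [IsFiniteMeasure μ]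
    (hpos : ∀ U : Set ES, IsOpen U → U.Nonempty → 0 < μ U) (u : ES) (hu : u ≠ 0) :
    StrictMono (fun t => GG μ u t) := by
  intro t t' htt
  have key : ∫ x, Set.indicator {x : ES | t < inner ℝ x u ∧ inner ℝ x u < t'}
      (fun _ => (1 : ℝ)) x ∂μ ≤ GG μ u t' - GG μ u t := by
    unfold GG
    rw [← integral_sub (int_bdd μ _ (GG_meas u t') fun x => th_abs _)
      (int_bdd μ _ (GG_meas u t) fun x => th_abs _)]
    have hms : MeasurableSet {x : ES | t < inner ℝ x u ∧ inner ℝ x u < t'} :=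
      (measurableSet_lt measurable_const (inner_meas u)).inter
        (measurableSet_lt (inner_meas u) measurable_const)
    apply integral_mono ((integrable_const _).indicator hms)
      ((int_bdd μ _ (GG_meas u t') fun x => th_abs _).sub
      (int_bdd μ _ (GG_meas u t) fun x => th_abs _))
    intro x
    simp only [Set.indicator_apply, Set.mem_ofPred_eq, th, sub_pos, Pi.sub_apply]
    split_ifs with h1 h2 h3 h4 h5 <;> first | (norm_num; done) | skip
    all_goals (exfalso; grind)
  have hms : IsOpen {x : ES | t < inner ℝ x u ∧ inner ℝ x u < t'} := by
    have hc : Continuous fun x : ES => (inner ℝ x u : ℝ) := by fun_prop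
    exact (isOpen_lt continuous_const hc).inter (isOpen_lt hc continuous_const)
  rw [integral_indicator hms.measurableSet] at key
  have hp := hpos _ hms (by
    refine ⟨(((t + t') / 2) / ‖u‖ ^ 2) • u, ?_⟩
    have hn : ‖u‖ ^ 2 ≠ 0 := by simpa using hu
    simp only [Set.mem_ofPred_eq, inner_smul_left, real_inner_self_eq_norm_sq]
    simp only [conj_trivial]
    rw [div_mul_cancel₀ _ hn]
    constructor <;> linarith)
  have hp2 : 0 < μ.real {x : ES | t < inner ℝ x u ∧ inner ℝ x u < t'} :=
    ENNReal.toReal_pos hp.ne' (measure_ne_top _ _)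
  simp at key
  show GG μ u t < GG μ u t'
  linarith

lemma quant_ex (μ : Measure ES) [IsFiniteMeasure μ] (hac : μ ≪ volume)
    (u : ES) (hu : u ≠ 0) (c : ℝ) (h0 : 0 < c)
    (h1 : c < μ.real Set.univ) : ∃ t, GG μ u t = c := by
  have ha : ∃ a, GG μ u a ≤ c :=
    (((GG_bot μ u).eventually (Iio_mem_nhds h0)).exists).imp fun a h => le_of_lt h
  have hb : ∃ a, c ≤ GG μ u a :=
    (((GG_top μ u).eventually (Ioi_mem_nhds h1)).exists).imp fun a h => le_of_lt h
  exact mem_range_of_exists_le_of_exists_ge (GG_cont_t μ hac u hu) ha hb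

open Classical in
/-- quantile -/
noncomputable def qt (μ : Measure ES) (u : ES) (i : ℕ) : ℝ :=
  if h : ∃ t, GG μ u t = (i : ℝ) / 15 * μ.real Set.univ then h.choose else 0

section
variable (μ : Measure ES) [IsFiniteMeasure μ] (hac : μ ≪ volume)
    (hpos : ∀ U : Set ES, IsOpen U → U.Nonempty → 0 < μ U)

lemma M_pos (hpos : ∀ U : Set ES, IsOpen U → U.Nonempty → 0 < μ U) : 0 < μ.real Set.univ :=
  ENNReal.toReal_pos (hpos _ isOpen_univ Set.univ_nonempty).ne' (measure_ne_top _ _)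

lemma qt_spec (hac : μ ≪ volume) (hpos : ∀ U : Set ES, IsOpen U → U.Nonempty → 0 < μ U)
    (u : ES) (hu : u ≠ 0) (i : ℕ) (h1 : 1 ≤ i) (h2 : i ≤ 14) :
    GG μ u (qt μ u i) = (i : ℝ) / 15 * μ.real Set.univ := by
  have hM := M_pos μ hpos
  have h1' : (1 : ℝ) ≤ i := by exact_mod_cast h1
  have h2' : (i : ℝ) ≤ 14 := by exact_mod_cast h2
  have h : ∃ t, GG μ u t = (i : ℝ) / 15 * μ.real Set.univ :=
    quant_ex μ hac u hu _ (by positivity) (by nlinarith)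
  rw [qt, dif_pos h]
  exact h.choose_spec

lemma qt_cont (hac : μ ≪ volume) (hpos : ∀ U : Set ES, IsOpen U → U.Nonempty → 0 < μ U)
    (u : ES) (hu : u ≠ 0) (i : ℕ) (h1 : 1 ≤ i) (h2 : i ≤ 14) :
    ContinuousAt (fun u => qt μ u i) u := by
  rw [Metric.continuousAt_iff']
  intro ε hε
  have e0 := qt_spec μ hac hpos u hu i h1 h2
  have l1 : GG μ u (qt μ u i - ε) < (i : ℝ) / 15 * μ.real Set.univ := by
    rw [← e0]; exact GG_mono μ hpos u hu (by linarith)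
  have l2 : (i : ℝ) / 15 * μ.real Set.univ < GG μ u (qt μ u i + ε) := by
    rw [← e0]; exact GG_mono μ hpos u hu (by linarith)
  filter_upwards [(GG_cont_u μ hac u hu _).eventually (Iio_mem_nhds l1),
    (GG_cont_u μ hac u hu _).eventually (Ioi_mem_nhds l2), isOpen_ne.mem_nhds hu] with y g1 g2 hy
  have e1 := qt_spec μ hac hpos y hy i h1 h2
  rw [← e1] at g1
  rw [← e1] at g2
  have k1 := (GG_mono μ hpos y hy).lt_iff_lt.1 g1
  have k2 := (GG_mono μ hpos y hy).lt_iff_lt.1 g2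
  rw [Real.dist_eq, abs_lt]
  constructor <;> linarith

lemma qt_neg (hac : μ ≪ volume) (hpos : ∀ U : Set ES, IsOpen U → U.Nonempty → 0 < μ U)
    (u : ES) (hu : u ≠ 0) (i k : ℕ) (h1 : 1 ≤ i) (h2 : i ≤ 14) (hk : i + k = 15) :
    qt μ (-u) i = - qt μ u k := by
  apply (GG_mono μ hpos (-u) (neg_ne_zero.2 hu)).injective
  simp only
  rw [qt_spec μ hac hpos (-u) (neg_ne_zero.2 hu) i h1 h2, GG_neg μ hac u hu,
    qt_spec μ hac hpos u hu k (by omega) (by omega)]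
  have : (i : ℝ) + k = 15 := by exact_mod_cast hk
  have : (i : ℝ) = 15 - k := by linarith
  rw [this]; ring

lemma qt_lt (hac : μ ≪ volume) (hpos : ∀ U : Set ES, IsOpen U → U.Nonempty → 0 < μ U)
    (u : ES) (hu : u ≠ 0) (i k : ℕ) (h1 : 1 ≤ i) (h2 : i < k) (hk : k ≤ 14) :
    qt μ u i < qt μ u k := by
  apply (GG_mono μ hpos u hu).lt_iff_lt.1
  rw [qt_spec μ hac hpos u hu i h1 (by omega), qt_spec μ hac hpos u hu k (by omega) hk]
  have := M_pos μ hpos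
  gcongr

end

end EquiM

namespace EquiM

/-- slab indicator -/
noncomputable def si (u : ES) (t : ℕ → ℝ) (i : ℕ) (x : ES) : ℝ :=
  (if 1 ≤ i then th (inner ℝ x u - t i) else 1) *
    (if i + 1 ≤ 14 then th (t (i + 1) - inner ℝ x u) else 1)

lemma si_meas (u : ES) (t : ℕ → ℝ) (i : ℕ) : Measurable (si u t i) := by
  unfold si
  refine Measurable.mul ?_ ?_
  · split_ifs
    · exact th_meas.comp ((inner_meas u).sub measurable_const)
    · exact measurable_const
  · split_ifs
    · exact th_meas.comp (measurable_const.sub (inner_meas u))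
    · exact measurable_const

lemma abs_mul_le {a b : ℝ} (ha : |a| ≤ 1) (hb : |b| ≤ 1) : |a * b| ≤ 1 := by
  rw [abs_mul]
  exact mul_le_one₀ ha (abs_nonneg _) hb

lemma si_abs (u : ES) (t : ℕ → ℝ) (i : ℕ) (x : ES) : |si u t i x| ≤ 1 := by
  unfold si
  apply abs_mul_le
  · split_ifs
    · exact th_abs _
    · simp
  · split_ifs
    · exact th_abs _
    · simp

/-- sign factors -/
noncomputable def sf (g : ℕ) (v : ES) (s₁ : ℝ) (w : ES) (s₂ : ℝ) (x : ES) : ℝ :=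
  (if g = 1 then 1 else sg (inner ℝ x v - s₁)) * (if g = 0 then 1 else sg (inner ℝ x w - s₂))

lemma sf_meas (g : ℕ) (v : ES) (s₁ : ℝ) (w : ES) (s₂ : ℝ) : Measurable (sf g v s₁ w s₂) := by
  unfold sf
  refine Measurable.mul ?_ ?_
  · split_ifs
    · exact measurable_const
    · exact sg_meas.comp ((inner_meas v).sub measurable_const)
  · split_ifs
    · exact measurable_const
    · exact sg_meas.comp ((inner_meas w).sub measurable_const)

lemma sf_abs (g : ℕ) (v : ES) (s₁ : ℝ) (w : ES) (s₂ : ℝ) (x : ES) : |sf g v s₁ w s₂ x| ≤ 1 := by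
  unfold sf
  apply abs_mul_le
  · split_ifs
    · simp
    · exact sg_abs _
  · split_ifs
    · simp
    · exact sg_abs _

noncomputable def XX (μ : Measure ES) (g i : ℕ) (u : ES) (t : ℕ → ℝ) (v : ES) (s₁ : ℝ)
    (w : ES) (s₂ : ℝ) : ℝ := ∫ x, si u t i x * sf g v s₁ w s₂ x ∂μ

noncomputable def nb (b : Fin 3) (ξ : Fin 45 → ℝ) : ℝ :=
  ‖(fun k => if Equi.blk k = b then ξ k else 0 : Fin 45 → ℝ)‖

lemma nb_cont (b : Fin 3) : Continuous (nb b) := by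
  unfold nb
  refine Continuous.norm (continuous_pi fun k => ?_)
  split_ifs
  · exact continuous_apply k
  · exact continuous_const

lemma nb_zero (b : Fin 3) (ξ : Fin 45 → ℝ) (h : ∀ k, Equi.blk k = b → ξ k = 0) : nb b ξ = 0 := by
  unfold nb
  rw [norm_eq_zero]
  funext k
  simp only [Pi.zero_apply, ite_eq_right_iff]
  exact h k

lemma nb_one (b : Fin 3) (ξ : Fin 45 → ℝ) (h : ∀ k, |ξ k| ≤ 1) (k : Fin 45)
    (hk : Equi.blk k = b) (h1 : |ξ k| = 1) : nb b ξ = 1 := by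
  unfold nb
  apply le_antisymm
  · rw [pi_norm_le_iff_of_nonneg zero_le_one]
    intro l
    split_ifs
    · exact h l
    · simp
  · have := norm_le_pi_norm (fun k => if Equi.blk k = b then ξ k else 0 : Fin 45 → ℝ) k
    simp only [hk, if_true, Real.norm_eq_abs, h1] at this
    exact this

/-- flip of a block -/
def fl (b : Fin 3) (ξ : Fin 45 → ℝ) : Fin 45 → ℝ := fun l => if Equi.blk l = b then - ξ l else ξ l

lemma nb_fl (b c : Fin 3) (ξ : Fin 45 → ℝ) : nb b (fl c ξ) = nb b ξ := by
  unfold nb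
  simp only [Pi.norm_def]
  congr 2
  funext k
  unfold fl
  split_ifs <;> simp

noncomputable def UU (ξ : Fin 45 → ℝ) : ES :=
  WithLp.toLp 2 fun i : Fin 16 => if h : (i : ℕ) < 15 then ξ ⟨i, by omega⟩ else 1 - nb 0 ξ

noncomputable def VV (ξ : Fin 45 → ℝ) : ES :=
  WithLp.toLp 2 fun i : Fin 16 => ξ ⟨i + 15, by omega⟩

noncomputable def WV (ξ : Fin 45 → ℝ) : ES :=
  WithLp.toLp 2 fun i : Fin 16 => if h : (i : ℕ) < 14 then ξ ⟨i + 31, by omega⟩ else 0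

lemma UU_cont : Continuous UU := by
  unfold UU
  refine (PiLp.continuous_toLp 2 _).comp (continuous_pi fun i => ?_)
  split_ifs
  · exact continuous_apply _
  · exact continuous_const.sub (nb_cont 0)

lemma VV_cont : Continuous VV := by
  unfold VV
  refine (PiLp.continuous_toLp 2 _).comp (continuous_pi fun i => ?_)
  exact continuous_apply _

lemma WV_cont : Continuous WV := by
  unfold WV
  refine (PiLp.continuous_toLp 2 _).comp (continuous_pi fun i => ?_)
  split_ifs
  · exact continuous_apply _
  · exact continuous_const

lemma blk0 (k : Fin 45) (h : (k : ℕ) < 15) : Equi.blk k = 0 := by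
  unfold Equi.blk; rw [if_pos h]
lemma blk1 (k : Fin 45) (h : 15 ≤ (k : ℕ)) (h' : (k : ℕ) < 31) : Equi.blk k = 1 := by
  unfold Equi.blk; rw [if_neg (by omega), if_pos h']
lemma blk2 (k : Fin 45) (h : 31 ≤ (k : ℕ)) : Equi.blk k = 2 := by
  unfold Equi.blk; rw [if_neg (by omega), if_neg (by omega)]
lemma blk0' (k : Fin 45) (h : Equi.blk k = 0) : (k : ℕ) < 15 := by
  unfold Equi.blk at h; split_ifs at h <;> first | assumption | simp at h
lemma blk1' (k : Fin 45) (h : Equi.blk k = 1) : 15 ≤ (k : ℕ) ∧ (k : ℕ) < 31 := by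
  unfold Equi.blk at h; split_ifs at h <;> first | omega | simp at h
lemma blk2' (k : Fin 45) (h : Equi.blk k = 2) : 31 ≤ (k : ℕ) := by
  unfold Equi.blk at h; split_ifs at h <;> first | omega | simp at h

lemma UU_ne (ξ : Fin 45 → ℝ) : UU ξ ≠ 0 := by
  intro h
  have hi : ∀ i : Fin 16, (if h : (i : ℕ) < 15 then ξ ⟨i, by omega⟩ else 1 - nb 0 ξ) = 0 := by
    intro i
    have := congrArg (fun z : ES => z i) h
    exact this
  have h1 : nb 0 ξ = 0 := by
    apply nb_zero
    intro k hk
    have hk' := blk0' k hk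
    have := hi ⟨k, by omega⟩
    simpa [hk'] using this
  have h2 := hi 15
  simp [h1] at h2

lemma VV_ne (ξ : Fin 45 → ℝ) : VV ξ ≠ 0 ∨ 1 - nb 1 ξ ≠ 0 := by
  by_contra hc
  push Not at hc
  obtain ⟨h, hs⟩ := hc
  have h1 : nb 1 ξ = 0 := by
    apply nb_zero
    intro k hk
    have hk' := blk1' k hk
    have := congrArg (fun z : ES => z ⟨k - 15, by omega⟩) h
    have h3 : ξ ⟨k - 15 + 15, by omega⟩ = 0 := this
    convert h3 using 2
    ext; simp; omega
  rw [h1] at hs; norm_num at hs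

lemma WV_ne (ξ : Fin 45 → ℝ) : WV ξ ≠ 0 ∨ 1 - nb 2 ξ ≠ 0 := by
  by_contra hc
  push Not at hc
  obtain ⟨h, hs⟩ := hc
  have h1 : nb 2 ξ = 0 := by
    apply nb_zero
    intro k hk
    have hk' := blk2' k hk
    have := congrArg (fun z : ES => z ⟨k - 31, by omega⟩) h
    have h3 : (if h : (k : ℕ) - 31 < 14 then ξ ⟨k - 31 + 31, by omega⟩ else 0) = 0 := this
    rw [dif_pos (by omega)] at h3
    convert h3 using 2
    ext; simp; omega
  rw [h1] at hs; norm_num at hs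

lemma UU_fl (ξ : Fin 45 → ℝ) (h1 : nb 0 ξ = 1) : UU (fl 0 ξ) = - UU ξ := by
  ext i
  show (if h : (i : ℕ) < 15 then fl 0 ξ ⟨i, by omega⟩ else 1 - nb 0 (fl 0 ξ)) =
    - (if h : (i : ℕ) < 15 then ξ ⟨i, by omega⟩ else 1 - nb 0 ξ)
  rw [nb_fl, h1]
  split_ifs with h
  · unfold fl; rw [if_pos (blk0 _ h)]
  · simp

lemma UU_fl' (b : Fin 3) (hb : b ≠ 0) (ξ : Fin 45 → ℝ) : UU (fl b ξ) = UU ξ := by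
  ext i
  show (if h : (i : ℕ) < 15 then fl b ξ ⟨i, by omega⟩ else 1 - nb 0 (fl b ξ)) =
    (if h : (i : ℕ) < 15 then ξ ⟨i, by omega⟩ else 1 - nb 0 ξ)
  rw [nb_fl]
  split_ifs with h
  · unfold fl; rw [blk0 _ h, if_neg hb.symm]
  · rfl

lemma VV_fl (ξ : Fin 45 → ℝ) : VV (fl 1 ξ) = - VV ξ := by
  ext i
  show fl 1 ξ ⟨i + 15, by omega⟩ = - ξ ⟨i + 15, by omega⟩
  unfold fl; rw [if_pos (blk1 _ (by simp) (by simp; omega))]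

lemma VV_fl' (b : Fin 3) (hb : b ≠ 1) (ξ : Fin 45 → ℝ) : VV (fl b ξ) = VV ξ := by
  ext i
  show fl b ξ ⟨i + 15, by omega⟩ = ξ ⟨i + 15, by omega⟩
  unfold fl; rw [blk1 _ (by simp) (by simp; omega), if_neg hb.symm]

lemma WV_fl (ξ : Fin 45 → ℝ) : WV (fl 2 ξ) = - WV ξ := by
  ext i
  show (if h : (i : ℕ) < 14 then fl 2 ξ ⟨i + 31, by omega⟩ else 0) =
    - (if h : (i : ℕ) < 14 then ξ ⟨i + 31, by omega⟩ else 0)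
  split_ifs with h
  · unfold fl; rw [if_pos (blk2 _ (by simp))]
  · simp

lemma WV_fl' (b : Fin 3) (hb : b ≠ 2) (ξ : Fin 45 → ℝ) : WV (fl b ξ) = WV ξ := by
  ext i
  show (if h : (i : ℕ) < 14 then fl b ξ ⟨i + 31, by omega⟩ else 0) =
    (if h : (i : ℕ) < 14 then ξ ⟨i + 31, by omega⟩ else 0)
  split_ifs with h
  · unfold fl; rw [blk2 _ (by simp), if_neg hb.symm]
  · rfl

noncomputable def XF (μ : Measure ES) (g i : ℕ) (ξ : Fin 45 → ℝ) : ℝ :=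
  XX μ g i (UU ξ) (qt μ (UU ξ)) (VV ξ) (1 - nb 1 ξ) (WV ξ) (1 - nb 2 ξ)

noncomputable def FF (μ : Measure ES) (ξ : Fin 45 → ℝ) (j : Fin 45) : ℝ :=
  if (j : ℕ) % 15 < 8 then XF μ (j / 15) (j % 15) ξ + XF μ (j / 15) (14 - j % 15) ξ
  else XF μ (j / 15) (j % 15 - 8) ξ - XF μ (j / 15) (14 - (j % 15 - 8)) ξ

section
variable (μ : Measure ES) [IsFiniteMeasure μ]

lemma XF_cont (hac : μ ≪ volume) (hpos : ∀ U : Set ES, IsOpen U → U.Nonempty → 0 < μ U)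
    (g i : ℕ) (hi2 : i ≤ 14) : Continuous (XF μ g i) := by
  rw [continuous_iff_continuousAt]
  intro ξ
  unfold XF XX
  apply cont_int
  · intro a; exact (si_meas _ _ _).mul (sf_meas _ _ _ _ _)
  · intro a x; exact abs_mul_le (si_abs _ _ _ _) (sf_abs _ _ _ _ _ _)
  · have hq : ∀ i, 1 ≤ i → i ≤ 14 → ContinuousAt (fun ξ => qt μ (UU ξ) i) ξ := fun i h1 h2 =>
      ContinuousAt.comp (g := fun u => qt μ u i) (f := UU)
        (qt_cont μ hac hpos (UU ξ) (UU_ne ξ) i h1 h2) UU_cont.continuousAt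
    have n1 := nb_cont 1
    have n2 := nb_cont 2
    have hU := UU_cont
    have hV := VV_cont
    have hW := WV_cont
    filter_upwards [hyper_null μ hac (UU ξ) (qt μ (UU ξ) i) (Or.inl (UU_ne ξ)),
      hyper_null μ hac (UU ξ) (qt μ (UU ξ) (i + 1)) (Or.inl (UU_ne ξ)),
      hyper_null μ hac (VV ξ) (1 - nb 1 ξ) (VV_ne ξ),
      hyper_null μ hac (WV ξ) (1 - nb 2 ξ) (WV_ne ξ)] with x h1 h2 h3 h4
    have iU : Continuous fun ξ => (inner ℝ x (UU ξ) : ℝ) := by fun_prop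
    have iV : Continuous fun ξ => (inner ℝ x (VV ξ) - (1 - nb 1 ξ) : ℝ) := by fun_prop
    have iW : Continuous fun ξ => (inner ℝ x (WV ξ) - (1 - nb 2 ξ) : ℝ) := by fun_prop
    unfold si sf
    refine ContinuousAt.mul (ContinuousAt.mul ?_ ?_) (ContinuousAt.mul ?_ ?_)
    · split_ifs with hi
      · exact ContinuousAt.comp (g := th) (f := fun ξ => inner ℝ x (UU ξ) - qt μ (UU ξ) i)
            (th_cont (sub_ne_zero.2 h1)) (iU.continuousAt.sub (hq i hi hi2))
      · exact continuousAt_const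
    · split_ifs with hi
      · exact ContinuousAt.comp (g := th) (f := fun ξ => qt μ (UU ξ) (i + 1) - inner ℝ x (UU ξ))
            (th_cont (sub_ne_zero.2 h2.symm)) ((hq (i + 1) (by omega) hi).sub iU.continuousAt)
      · exact continuousAt_const
    · split_ifs with hi
      · exact continuousAt_const
      · exact ContinuousAt.comp (g := sg) (f := fun ξ => inner ℝ x (VV ξ) - (1 - nb 1 ξ))
            (sg_cont (sub_ne_zero.2 h3)) iV.continuousAt
    · split_ifs with hi
      · exact continuousAt_const
      · exact ContinuousAt.comp (g := sg) (f := fun ξ => inner ℝ x (WV ξ) - (1 - nb 2 ξ))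
            (sg_cont (sub_ne_zero.2 h4)) iW.continuousAt

lemma FF_cont (hac : μ ≪ volume) (hpos : ∀ U : Set ES, IsOpen U → U.Nonempty → 0 < μ U) :
    Continuous (FF μ) := by
  refine continuous_pi fun j => ?_
  unfold FF
  split_ifs with h
  · exact (XF_cont μ hac hpos _ _ (by omega)).add (XF_cont μ hac hpos _ _ (by omega))
  · exact (XF_cont μ hac hpos _ _ (by omega)).sub (XF_cont μ hac hpos _ _ (by omega))

lemma si_neg (hac : μ ≪ volume) (hpos : ∀ U : Set ES, IsOpen U → U.Nonempty → 0 < μ U)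
    (u : ES) (hu : u ≠ 0) (i k : ℕ) (hk : i + k = 14) (x : ES) :
    si (-u) (qt μ (-u)) i x = si u (qt μ u) k x := by
  unfold si
  rw [mul_comm]
  congr 1
  · by_cases h : 1 ≤ k
    · rw [if_pos h, if_pos (by omega), qt_neg μ hac hpos u hu (i + 1) k (by omega) (by omega)
        (by omega), inner_neg_right]
      congr 1; ring
    · rw [if_neg h, if_neg (by omega)]
  · by_cases h : 1 ≤ i
    · rw [if_pos h, if_pos (by omega), qt_neg μ hac hpos u hu i (k + 1) (by omega) (by omega)
        (by omega), inner_neg_right]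
      congr 1; ring
    · rw [if_neg h, if_neg (by omega)]

lemma XF_fl0 (hac : μ ≪ volume) (hpos : ∀ U : Set ES, IsOpen U → U.Nonempty → 0 < μ U)
    (ξ : Fin 45 → ℝ) (h1 : nb 0 ξ = 1) (g i k : ℕ) (hk : i + k = 14) :
    XF μ g i (fl 0 ξ) = XF μ g k ξ := by
  unfold XF XX
  rw [UU_fl ξ h1, VV_fl' 0 (by decide), WV_fl' 0 (by decide), nb_fl, nb_fl]
  simp only [si_neg μ hac hpos (UU ξ) (UU_ne ξ) i k hk]

lemma XF_fl1 (ξ : Fin 45 → ℝ) (h1 : nb 1 ξ = 1) (g i : ℕ) :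
    XF μ g i (fl 1 ξ) = (if g ≠ 1 then -1 else 1) * XF μ g i ξ := by
  unfold XF XX
  rw [UU_fl' 1 (by decide), VV_fl, WV_fl' 1 (by decide), nb_fl, nb_fl, h1, ← integral_const_mul]
  congr 1
  funext x
  unfold sf
  by_cases hg : g = 1
  · simp [hg]
  · simp only [hg, if_false, ne_eq, not_false_eq_true, if_true, inner_neg_right, sub_self, sub_zero,
      sg_neg]
    ring

lemma XF_fl2 (ξ : Fin 45 → ℝ) (h1 : nb 2 ξ = 1) (g i : ℕ) :
    XF μ g i (fl 2 ξ) = (if 1 ≤ g then -1 else 1) * XF μ g i ξ := by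
  unfold XF XX
  rw [UU_fl' 2 (by decide), VV_fl' 2 (by decide), WV_fl, nb_fl, nb_fl, h1, ← integral_const_mul]
  congr 1
  funext x
  unfold sf
  by_cases hg : g = 0
  · simp [hg]
  · have hg' : 1 ≤ g := by omega
    simp only [hg, hg', if_false, if_true, inner_neg_right, sub_self, sub_zero,
      sg_neg]
    ring

lemma FF_eqv (hac : μ ≪ volume) (hpos : ∀ U : Set ES, IsOpen U → U.Nonempty → 0 < μ U)
    (x : Fin 45 → ℝ) (hx : ∀ k, |x k| ≤ 1) (k : Fin 45) (hk : |x k| = 1) (j : Fin 45) :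
    FF μ (fun l => if Equi.blk l = Equi.blk k then - x l else x l) j =
        (if Equi.mask j (Equi.blk k) then -1 else 1) * FF μ x j := by
  change FF μ (fl (Equi.blk k) x) j = _
  have h1 := nb_one _ x hx k rfl hk
  generalize Equi.blk k = b at h1
  have h45 := j.2
  fin_cases b
  · change FF μ (fl 0 x) j = (if Equi.mask j 0 then -1 else 1) * _
    change nb 0 x = 1 at h1
    unfold FF Equi.mask
    by_cases h : (j : ℕ) % 15 < 8
    · rw [if_pos h, if_pos h, XF_fl0 μ hac hpos x h1 _ _ (14 - j % 15) (by omega),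
        XF_fl0 μ hac hpos x h1 _ (14 - j % 15) (j % 15) (by omega)]
      have : ¬ (8 ≤ (j : ℕ) % 15) := by omega
      simp [this]; ring
    · rw [if_neg h, if_neg h, XF_fl0 μ hac hpos x h1 _ _ (14 - (j % 15 - 8)) (by omega),
        XF_fl0 μ hac hpos x h1 _ (14 - (j % 15 - 8)) (j % 15 - 8) (by omega)]
      have : (8 ≤ (j : ℕ) % 15) := by omega
      simp [this]
  · change FF μ (fl 1 x) j = (if Equi.mask j 1 then -1 else 1) * _
    change nb 1 x = 1 at h1
    unfold FF Equi.mask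
    simp only [XF_fl1 μ x h1, decide_eq_true_eq]
    split_ifs <;> ring
  · change FF μ (fl 2 x) j = (if Equi.mask j 2 then -1 else 1) * _
    change nb 2 x = 1 at h1
    unfold FF Equi.mask
    simp only [XF_fl2 μ x h1, decide_eq_true_eq]
    split_ifs <;> ring

lemma zero_ex (hac : μ ≪ volume) (hpos : ∀ U : Set ES, IsOpen U → U.Nonempty → 0 < μ U) :
    ∃ ξ : Fin 45 → ℝ, ∀ g ≤ 2, ∀ i ≤ 14, XF μ g i ξ = 0 := by
  obtain ⟨ξ, -, h⟩ := Equi.topo (FF μ) (FF_cont μ hac hpos) (FF_eqv μ hac hpos)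
  refine ⟨ξ, fun g hg => ?_⟩
  have key1 : ∀ i, i < 8 → XF μ g i ξ + XF μ g (14 - i) ξ = 0 := by
    intro i hi
    have := h ⟨15 * g + i, by omega⟩
    unfold FF at this
    have e1 : (15 * g + i) / 15 = g := by omega
    have e2 : (15 * g + i) % 15 = i := by omega
    simp only [e1, e2, hi, if_true] at this
    exact this
  have key2 : ∀ i, i < 7 → XF μ g i ξ - XF μ g (14 - i) ξ = 0 := by
    intro i hi
    have := h ⟨15 * g + (i + 8), by omega⟩
    unfold FF at this
    have e1 : (15 * g + (i + 8)) / 15 = g := by omega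
    have e2 : (15 * g + (i + 8)) % 15 = i + 8 := by omega
    have e3 : ¬ (i + 8 < 8) := by omega
    simp only [e1, e2, e3, if_false, Nat.add_sub_cancel] at this
    exact this
  intro i hi
  rcases lt_trichotomy i 7 with h7 | h7 | h7
  · have a1 := key1 i (by omega)
    have a2 := key2 i (by omega)
    linarith
  · have a1 := key1 7 (by omega)
    subst h7
    norm_num at a1
    linarith
  · have a1 := key1 (14 - i) (by omega)
    have a2 := key2 (14 - i) (by omega)
    have : 14 - (14 - i) = i := by omega
    rw [this] at a1 a2
    linarith

end

end EquiM

namespace EquiM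

section
variable (μ : Measure ES) [IsFiniteMeasure μ]

lemma si_int (hac : μ ≪ volume) (hpos : ∀ U : Set ES, IsOpen U → U.Nonempty → 0 < μ U)
    (u : ES) (hu : u ≠ 0) (i : ℕ) (hi : i ≤ 14) :
    ∫ x, si u (qt μ u) i x ∂μ = μ.real Set.univ / 15 := by
  have h1 : ∫ x, si u (qt μ u) i x ∂μ =
      (if i + 1 ≤ 14 then GG μ u (qt μ u (i + 1)) else μ.real Set.univ) -
      (if 1 ≤ i then GG μ u (qt μ u i) else 0) := by
    have e1 : (if i + 1 ≤ 14 then GG μ u (qt μ u (i + 1)) else μ.real Set.univ) =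
        ∫ x, (if i + 1 ≤ 14 then th (qt μ u (i + 1) - inner ℝ x u) else 1) ∂μ := by
      split_ifs
      · rfl
      · simp
    have e2 : (if 1 ≤ i then GG μ u (qt μ u i) else 0) =
        ∫ x, (if 1 ≤ i then th (qt μ u i - inner ℝ x u) else 0) ∂μ := by
      split_ifs
      · rfl
      · simp
    rw [e1, e2, ← integral_sub]
    · apply integral_congr_ae
      filter_upwards [hyper_null μ hac u (qt μ u i) (Or.inl hu)] with x hx
      have hlt : 1 ≤ i → i + 1 ≤ 14 → qt μ u i < qt μ u (i + 1) := fun a b =>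
        qt_lt μ hac hpos u hu i (i + 1) a (by omega) b
      unfold si th
      simp only [sub_pos]
      generalize (inner ℝ x u : ℝ) = y at *
      rcases lt_or_gt_of_ne hx with h | h
      · have hn := h.not_gt
        by_cases c1 : 1 ≤ i
        · by_cases c2 : i + 1 ≤ 14
          · have h2 : y < qt μ u (i + 1) := h.trans (hlt c1 c2)
            simp [c1, c2, h, hn, h2]
          · simp [c1, c2, h, hn]
        · simp [c1]
      · have hn := h.not_gt
        by_cases c1 : 1 ≤ i
        · simp [c1, h, hn]
        · simp [c1]
    · split_ifs
      · exact int_bdd μ _ (GG_meas _ _) fun x => th_abs _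
      · exact integrable_const _
    · split_ifs
      · exact int_bdd μ _ (GG_meas _ _) fun x => th_abs _
      · exact integrable_const _
  rw [h1]
  split_ifs with c1 c2 c2
  · rw [qt_spec μ hac hpos u hu _ (by omega) c1, qt_spec μ hac hpos u hu _ c2 hi]
    push_cast; ring
  · have : i = 0 := by omega
    subst this
    rw [qt_spec μ hac hpos u hu _ (by omega) c1]
    push_cast; ring
  · have : i = 14 := by omega
    subst this
    rw [qt_spec μ hac hpos u hu _ (by omega) hi]
    push_cast; ring
  · omega

lemma box_meas (u v w : ES) (t : ℕ → ℝ) (s₁ s₂ : ℝ) (i : ℕ) (b₁ b₂ : Bool) :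
    MeasurableSet (slab u t 14 i ∩ halfSp v s₁ b₁ ∩ halfSp w s₂ b₂) := by
  have hh : ∀ (v : ES) (s : ℝ) (b : Bool), MeasurableSet (halfSp v s b) := by
    intro v s b
    unfold halfSp
    split_ifs
    · exact measurableSet_lt (inner_meas v) measurable_const
    · exact measurableSet_lt measurable_const (inner_meas v)
  refine MeasurableSet.inter (MeasurableSet.inter ?_ (hh _ _ _)) (hh _ _ _)
  unfold slab
  have e : {x : ES | (1 ≤ i → t i < (inner ℝ x u : ℝ)) ∧
      (i + 1 ≤ 14 → (inner ℝ x u : ℝ) < t (i + 1))} =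
      {x : ES | 1 ≤ i → t i < (inner ℝ x u : ℝ)} ∩
      {x : ES | i + 1 ≤ 14 → (inner ℝ x u : ℝ) < t (i + 1)} := rfl
  rw [e]
  refine MeasurableSet.inter ?_ ?_
  · by_cases h : 1 ≤ i
    · simp only [h, true_imp_iff]
      exact measurableSet_lt measurable_const (inner_meas u)
    · simp [h]
  · by_cases h : i + 1 ≤ 14
    · simp only [h, true_imp_iff]
      exact measurableSet_lt (inner_meas u) measurable_const
    · simp [h]

lemma si_ind (u : ES) (t : ℕ → ℝ) (i : ℕ) (x : ES) [Decidable (x ∈ slab u t 14 i)] :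
    si u t i x = if x ∈ slab u t 14 i then 1 else 0 := by
  have hm : x ∈ slab u t 14 i ↔ (1 ≤ i → t i < (inner ℝ x u : ℝ)) ∧
      (i + 1 ≤ 14 → (inner ℝ x u : ℝ) < t (i + 1)) := Iff.rfl
  unfold si th
  simp only [sub_pos, hm]
  by_cases c1 : 1 ≤ i <;> by_cases c2 : i + 1 ≤ 14 <;>
    by_cases c3 : t i < (inner ℝ x u : ℝ) <;> by_cases c4 : (inner ℝ x u : ℝ) < t (i + 1) <;>
    simp [c1, c2, c3, c4]

/-- sign of a side -/
def sd (b : Bool) : ℝ := if b then -1 else 1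

lemma half_ind (v : ES) (s : ℝ) (b : Bool) (x : ES) (hx : (inner ℝ x v : ℝ) ≠ s)
    [Decidable (x ∈ halfSp v s b)] :
    (1 + sd b * sg (inner ℝ x v - s)) / 2 = if x ∈ halfSp v s b then 1 else 0 := by
  unfold sd sg
  cases b
  · have hm : x ∈ halfSp v s false ↔ s < (inner ℝ x v : ℝ) := Iff.rfl
    simp only [hm, sub_pos, sub_neg]
    rcases lt_or_gt_of_ne hx with h | h
    · simp [h, h.not_gt]
    · simp [h]
  · have hm : x ∈ halfSp v s true ↔ (inner ℝ x v : ℝ) < s := Iff.rfl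
    simp only [hm, sub_pos, sub_neg]
    rcases lt_or_gt_of_ne hx with h | h
    · simp [h, h.not_gt]
    · simp [h, h.not_gt]

lemma box_val (hac : μ ≪ volume) (hpos : ∀ U : Set ES, IsOpen U → U.Nonempty → 0 < μ U)
    (ξ : Fin 45 → ℝ) (hξ : ∀ g ≤ 2, ∀ i ≤ 14, XF μ g i ξ = 0) (i : ℕ) (hi : i ≤ 14)
    (b₁ b₂ : Bool) :
    μ.real (slab (UU ξ) (qt μ (UU ξ)) 14 i ∩ halfSp (VV ξ) (1 - nb 1 ξ) b₁ ∩
      halfSp (WV ξ) (1 - nb 2 ξ) b₂) = μ.real Set.univ / 60 := by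
  classical
  have hA := hξ 0 (by norm_num) i hi
  have hB := hξ 1 (by norm_num) i hi
  have hC := hξ 2 (by norm_num) i hi
  unfold XF XX at hA hB hC
  set u := UU ξ
  set v := VV ξ
  set w := WV ξ
  set s₁ := 1 - nb 1 ξ
  set s₂ := 1 - nb 2 ξ
  have hS := si_int μ hac hpos u (UU_ne ξ) i hi
  have hInteg : ∀ g, Integrable (fun x => si u (qt μ u) i x * sf g v s₁ w s₂ x) μ := fun g =>
    int_bdd μ _ ((si_meas _ _ _).mul (sf_meas _ _ _ _ _))
      fun x => abs_mul_le (si_abs _ _ _ _) (sf_abs _ _ _ _ _ _)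
  have hInteg0 : Integrable (fun x => si u (qt μ u) i x) μ :=
    int_bdd μ _ (si_meas _ _ _) (si_abs _ _ _)
  have e : μ.real (slab u (qt μ u) 14 i ∩ halfSp v s₁ b₁ ∩ halfSp w s₂ b₂) =
      ∫ x, (1 / 4) * (si u (qt μ u) i x + sd b₁ * (si u (qt μ u) i x * sf 0 v s₁ w s₂ x) +
        sd b₂ * (si u (qt μ u) i x * sf 1 v s₁ w s₂ x) +
        sd b₁ * sd b₂ * (si u (qt μ u) i x * sf 2 v s₁ w s₂ x)) ∂μ := by
    rw [← integral_indicator_one (box_meas u v w (qt μ u) s₁ s₂ i b₁ b₂)]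
    apply integral_congr_ae
    filter_upwards [hyper_null μ hac v s₁ (VV_ne ξ), hyper_null μ hac w s₂ (WV_ne ξ)] with x h1 h2
    have a1 := si_ind u (qt μ u) i x
    have a2 := half_ind v s₁ b₁ x h1
    have a3 := half_ind w s₂ b₂ x h2
    have : Set.indicator (slab u (qt μ u) 14 i ∩ halfSp v s₁ b₁ ∩ halfSp w s₂ b₂)
        (1 : ES → ℝ) x = (if x ∈ slab u (qt μ u) 14 i then 1 else 0) *
        (if x ∈ halfSp v s₁ b₁ then 1 else 0) * (if x ∈ halfSp w s₂ b₂ then 1 else 0) := by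
      simp only [Set.indicator_apply, Set.mem_inter_iff, Pi.one_apply]
      split_ifs <;> simp_all
    rw [this, ← a1, ← a2, ← a3]
    simp only [sf]
    norm_num
    ring
  rw [e, integral_const_mul, integral_add, integral_add, integral_add, integral_const_mul,
    integral_const_mul, integral_const_mul, hA, hB, hC, hS]
  · ring
  · exact hInteg0
  · exact (hInteg 0).const_mul _
  · exact hInteg0.add ((hInteg 0).const_mul _)
  · exact (hInteg 1).const_mul _
  · exact (hInteg0.add ((hInteg 0).const_mul _)).add ((hInteg 1).const_mul _)
  · exact (hInteg 2).const_mul _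

end

lemma half_scale (v : ES) (s c : ℝ) (hc : 0 < c) (b : Bool) :
    halfSp (c • v) (c * s) b = halfSp v s b := by
  unfold halfSp
  cases b <;> simp [inner_smul_right, mul_lt_mul_iff_right₀ hc]

lemma slab_scale (v : ES) (t : ℕ → ℝ) (c : ℝ) (hc : 0 < c) (n i : ℕ) :
    slab (c • v) (fun i => c * t i) n i = slab v t n i := by
  unfold slab
  simp [inner_smul_right, mul_lt_mul_iff_right₀ hc]

lemma half_false {v : ES} {s : ℝ} {x : ES} (h : x ∈ halfSp v s false) : s < inner ℝ x v := by
  simpa [halfSp] using h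

lemma half_true {v : ES} {s : ℝ} {x : ES} (h : x ∈ halfSp v s true) : inner ℝ x v < s := by
  simpa [halfSp] using h

lemma half_ne_zero {v : ES} {s : ℝ} (h : ∀ b, (halfSp v s b).Nonempty) : v ≠ 0 := by
  rintro rfl
  obtain ⟨x, hx⟩ := h true
  obtain ⟨y, hy⟩ := h false
  have a := half_true hx
  have b := half_false hy
  simp at a b
  linarith

/-- a hyperplane meeting the two extreme slabs on both sides is not parallel to the slabs -/
lemma not_par {u v : ES} {t : ℕ → ℝ} {s : ℝ} (ht : t 1 < t 14)
    (h : ∀ i ≤ 14, ∀ b, (slab u t 14 i ∩ halfSp v s b).Nonempty) : v ≠ u ∧ v ≠ -u := by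
  constructor
  · rintro rfl
    obtain ⟨x, hx, hx'⟩ := h 0 (by norm_num) false
    obtain ⟨y, hy, hy'⟩ := h 14 (by norm_num) true
    have a := half_false hx'
    have b := half_true hy'
    have c := hx.2 (by norm_num)
    have d := hy.1 (by norm_num)
    simp only [zero_add] at c
    linarith
  · rintro rfl
    obtain ⟨x, hx, hx'⟩ := h 0 (by norm_num) true
    obtain ⟨y, hy, hy'⟩ := h 14 (by norm_num) false
    have a := half_true hx'
    have b := half_false hy'
    have c := hx.2 (by norm_num)
    have d := hy.1 (by norm_num)
    simp only [zero_add] at c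
    simp only [inner_neg_right] at a b
    linarith

lemma not_par2 {v w : ES} {s₁ s₂ : ℝ}
    (h : ∀ b b', (halfSp v s₁ b ∩ halfSp w s₂ b').Nonempty) : w ≠ v ∧ w ≠ -v := by
  constructor
  · rintro rfl
    obtain ⟨x, hx, hx'⟩ := h true false
    obtain ⟨y, hy, hy'⟩ := h false true
    have a := half_true hx
    have b := half_false hx'
    have c := half_false hy
    have d := half_true hy'
    linarith
  · rintro rfl
    obtain ⟨x, hx, hx'⟩ := h true true
    obtain ⟨y, hy, hy'⟩ := h false false
    have a := half_true hx
    have b := half_true hx'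
    have c := half_false hy
    have d := half_false hy'
    simp only [inner_neg_right] at b d
    linarith

lemma norm_unit {v : ES} (h : v ≠ 0) : ‖(‖v‖⁻¹ : ℝ) • v‖ = 1 := by
  rw [norm_smul, norm_inv, norm_norm, inv_mul_cancel₀ (norm_ne_zero_iff.2 h)]

end EquiM

/-- Every mass distribution in `ℝ^16` admits an equipartition into `60` boxes
by a collection of `14` parallel hyperplanes and two additional non-parallel
hyperplanes. -/
theorem equipartition_R16_60_boxes
    (μ : Measure (EuclideanSpace ℝ (Fin 16)))
    (f : EuclideanSpace ℝ (Fin 16) → ℝ) (hf : Integrable f)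
    (hμ : ∀ A : Set (EuclideanSpace ℝ (Fin 16)), MeasurableSet A →
      μ A = ENNReal.ofReal (∫ x in A, f x))
    (hpos : ∀ U : Set (EuclideanSpace ℝ (Fin 16)), IsOpen U → U.Nonempty → 0 < μ U) :
    ∃ (u v w : EuclideanSpace ℝ (Fin 16)) (t : ℕ → ℝ) (s₁ s₂ : ℝ),
      ‖u‖ = 1 ∧ ‖v‖ = 1 ∧ ‖w‖ = 1 ∧
      v ≠ u ∧ v ≠ -u ∧ w ≠ u ∧ w ≠ -u ∧ w ≠ v ∧ w ≠ -v ∧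
      StrictMonoOn t (Set.Icc 1 14) ∧
      ∀ i ≤ 14, ∀ b₁ b₂ : Bool,
        μ (slab u t 14 i ∩ halfSp v s₁ b₁ ∩ halfSp w s₂ b₂) =
          μ Set.univ / 60 := by
  have hfin : IsFiniteMeasure μ := ⟨by rw [hμ _ MeasurableSet.univ]; exact ENNReal.ofReal_lt_top⟩
  have hac : μ ≪ volume := by
    refine Measure.AbsolutelyContinuous.mk fun A hA h0 => ?_
    rw [hμ A hA, Measure.restrict_eq_zero.2 h0]
    simp
  obtain ⟨ξ, hξ⟩ := EquiM.zero_ex μ hac hpos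
  have hbox := EquiM.box_val μ hac hpos ξ hξ
  have hU := EquiM.UU_ne ξ
  have hM := EquiM.M_pos μ hpos
  have htm := fun i k h1 h2 h3 => EquiM.qt_lt μ hac hpos (EquiM.UU ξ) hU i k h1 h2 h3
  generalize EquiM.UU ξ = u at *
  generalize EquiM.VV ξ = v at *
  generalize EquiM.WV ξ = w at *
  generalize 1 - EquiM.nb 1 ξ = s₁ at *
  generalize 1 - EquiM.nb 2 ξ = s₂ at *
  generalize EquiM.qt μ u = t at *
  have hne : ∀ i ≤ 14, ∀ b₁ b₂ : Bool,
      (slab u t 14 i ∩ halfSp v s₁ b₁ ∩ halfSp w s₂ b₂).Nonempty := by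
    intro i hi b₁ b₂
    rw [Set.nonempty_iff_ne_empty]
    intro h
    have := hbox i hi b₁ b₂
    rw [h] at this
    rw [measureReal_empty] at this
    linarith
  have hv : v ≠ 0 := EquiM.half_ne_zero (s := s₁) fun b =>
    (hne 0 (by norm_num) b true).mono fun x hx => hx.1.2
  have hw : w ≠ 0 := EquiM.half_ne_zero (s := s₂) fun b =>
    (hne 0 (by norm_num) true b).mono fun x hx => hx.2
  have cu : 0 < ‖u‖⁻¹ := by positivity
  have cv : 0 < ‖v‖⁻¹ := by positivity
  have cw : 0 < ‖w‖⁻¹ := by positivity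
  have hsc : ∀ i b₁ b₂, slab (‖u‖⁻¹ • u) (fun i => ‖u‖⁻¹ * t i) 14 i ∩
      halfSp (‖v‖⁻¹ • v) (‖v‖⁻¹ * s₁) b₁ ∩ halfSp (‖w‖⁻¹ • w) (‖w‖⁻¹ * s₂) b₂ =
      slab u t 14 i ∩ halfSp v s₁ b₁ ∩ halfSp w s₂ b₂ := by
    intro i b₁ b₂
    rw [EquiM.slab_scale _ _ _ cu, EquiM.half_scale _ _ _ cv, EquiM.half_scale _ _ _ cw]
  have hne' : ∀ i ≤ 14, ∀ b₁ b₂ : Bool, (slab (‖u‖⁻¹ • u) (fun i => ‖u‖⁻¹ * t i) 14 i ∩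
      halfSp (‖v‖⁻¹ • v) (‖v‖⁻¹ * s₁) b₁ ∩ halfSp (‖w‖⁻¹ • w) (‖w‖⁻¹ * s₂) b₂).Nonempty := by
    intro i hi b₁ b₂
    rw [hsc]
    exact hne i hi b₁ b₂
  have htm' : (fun i => ‖u‖⁻¹ * t i) 1 < (fun i => ‖u‖⁻¹ * t i) 14 :=
    mul_lt_mul_of_pos_left (htm 1 14 (by norm_num) (by norm_num) (by norm_num)) cu
  have p1 := EquiM.not_par (v := ‖v‖⁻¹ • v) (s := ‖v‖⁻¹ * s₁) htm' fun i hi b =>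
    (hne' i hi b true).mono fun x hx => hx.1
  have p2 := EquiM.not_par (v := ‖w‖⁻¹ • w) (s := ‖w‖⁻¹ * s₂) htm' fun i hi b =>
    (hne' i hi true b).mono fun x hx => ⟨hx.1.1, hx.2⟩
  have p3 := EquiM.not_par2 (v := ‖v‖⁻¹ • v) (s₁ := ‖v‖⁻¹ * s₁) (w := ‖w‖⁻¹ • w)
    (s₂ := ‖w‖⁻¹ * s₂) fun b b' =>
    (hne' 0 (by norm_num) b b').mono fun x hx => ⟨hx.1.2, hx.2⟩
  refine ⟨‖u‖⁻¹ • u, ‖v‖⁻¹ • v, ‖w‖⁻¹ • w, fun i => ‖u‖⁻¹ * t i, ‖v‖⁻¹ * s₁, ‖w‖⁻¹ * s₂,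
    EquiM.norm_unit hU, EquiM.norm_unit hv, EquiM.norm_unit hw,
    p1.1, p1.2, p2.1, p2.2, p3.1, p3.2, ?_, ?_⟩
  · intro i hi k hk hik
    exact mul_lt_mul_of_pos_left (htm i k hi.1 hik hk.2) cu
  · intro i hi b₁ b₂
    rw [hsc]
    rw [← ENNReal.toReal_eq_toReal_iff' (measure_ne_top _ _)
      (ENNReal.div_ne_top (measure_ne_top _ _) (by norm_num)), ENNReal.toReal_div]
    exact hbox i hi b₁ b₂
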